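/- arXiv:1505.04917 — 3 statements merged into one kernel-verified Lean document; each statement's English description precedes it below -/
import Mathlib

section
/- Let D be a smoothly bounded complete pseudoconvex Reinhardt domain in ℂⁿ, and let K ⊆ ∂D be a multi-circular compact set that does not meet any of the coordinate hyperplanes {z_j = 0}. Then for every z ∈ D, ω₁(z, K, D) = ω(z, K, D) = ω̃(z, K, D) = ω₃(z, K, D); in particular all four upper semicontinuous regularizations coincide. -/
open Complex Metric MeasureTheory Filter Topology Set

noncomputable section

/-- The average of the truncation `max u (-m)` of an `EReal`-valued function `u` over the
circle of center `c` and radius `r`. -/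
noncomputable def truncCircleAvg (u : ℂ → EReal) (c : ℂ) (r : ℝ) (m : ℕ) : ℝ :=
  (2 * Real.pi)⁻¹ *
    ∫ θ in (0:ℝ)..(2 * Real.pi),
      (max (u (c + (r : ℂ) * Complex.exp (θ * Complex.I))) ((-(m : ℝ) : ℝ) : EReal)).toReal

/-- A `[-∞,∞]`-valued function is subharmonic on `U ⊆ ℂ` if it is upper semicontinuous
on `U` and satisfies the sub-mean value inequality on every closed disc contained in `U`
(expressed via averages of truncations from below). -/
def SubharmonicOn (u : ℂ → EReal) (U : Set ℂ) : Prop :=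
  UpperSemicontinuousOn u U ∧
    ∀ c r, 0 < r → Metric.closedBall c r ⊆ U →
      ∀ m : ℕ, u c ≤ ((truncCircleAvg u c r m : ℝ) : EReal)

variable {E : Type*} [NormedAddCommGroup E] [NormedSpace ℂ E]

/-- Plurisubharmonic on `D`: upper semicontinuous on `D`, with values in `[-∞, ∞)`,
whose restriction to every complex line is subharmonic.  (The constant `-∞` is allowed
here; the paper's class `PSH(D)` additionally requires `u ≢ -∞`, see `MemPSH`.) -/
def PshOn (u : E → EReal) (D : Set E) : Prop :=
  UpperSemicontinuousOn u D ∧ (∀ z ∈ D, u z ≠ ⊤) ∧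
    ∀ a b : E, SubharmonicOn (fun ζ : ℂ => u (a + ζ • b)) {ζ : ℂ | a + ζ • b ∈ D}

/-- Membership in the paper's class `PSH(D)`: plurisubharmonic and not identically `-∞`. -/
def MemPSH (u : E → EReal) (D : Set E) : Prop :=
  PshOn u D ∧ ∃ z ∈ D, u z ≠ ⊥

/-- The upper semicontinuous regularization `u*` of `u` on `cl(D)`:
`u*(x) = limsup_{z → x, z ∈ D} u(z)`. -/
noncomputable def uscReg (u : E → EReal) (D : Set E) (x : E) : EReal :=
  Filter.limsup u (nhdsWithin x D)

/-- The boundary relative extremal function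
`ω(z, A, D) = sup { u(z) : u ∈ PSH(D), u ≤ 0 on D, u* ≤ -1 on A }`. -/
noncomputable def bndExt (z : E) (A D : Set E) : EReal :=
  sSup {w : EReal | ∃ u : E → EReal, MemPSH u D ∧ (∀ y ∈ D, u y ≤ 0) ∧
    (∀ x ∈ A, uscReg u D x ≤ -1) ∧ w = u z}

/-- The upper semicontinuous regularization `ω*(·, A, D)` on `cl(D)`. -/
noncomputable def bndExtStar (x : E) (A D : Set E) : EReal :=
  Filter.limsup (fun z => bndExt z A D) (nhdsWithin x D)

/-- A bounded domain: a nonempty connected bounded open set. -/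
def IsBddDomain (D : Set E) : Prop :=
  IsOpen D ∧ IsConnected D ∧ Bornology.IsBounded D

/-- `A ⊆ ∂D` is b-pluripolar if there is `u ∈ PSH(D)`, `u ≤ 0`, `u ≢ -∞`,
with `u* = -∞` on `A`. -/
def BPluripolar (A D : Set E) : Prop :=
  ∃ u : E → EReal, PshOn u D ∧ (∀ z ∈ D, u z ≤ 0) ∧ (∃ z ∈ D, u z ≠ ⊥) ∧
    ∀ x ∈ A, uscReg u D x = ⊥

/-- The b-pluripolar hull `Â` of `A ⊆ ∂D`: all points `z ∈ cl(D)` such that `u*(z) = -∞`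
for every negative `u ∈ PSH(D)`, `u ≢ -∞`, with `u* = -∞` on `A`. -/
def bHull (A D : Set E) : Set E :=
  {z ∈ closure D | ∀ u : E → EReal, PshOn u D → (∀ y ∈ D, u y < 0) →
    (∃ y ∈ D, u y ≠ ⊥) → (∀ x ∈ A, uscReg u D x = ⊥) → uscReg u D z = ⊥}

/-- Weak regularity: for every relatively open `U ⊆ ∂D` one has `ω*(·, U, D) ≤ -1` on `U`. -/
def WeaklyRegular (D : Set E) : Prop :=
  ∀ U W : Set E, IsOpen W → U = W ∩ frontier D → ∀ x ∈ U, bndExtStar x U D ≤ -1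

/-- B-regularity (Sibony): every continuous `f : ∂D → ℝ` extends to a function
plurisubharmonic on `D` and continuous on `cl(D)` with boundary values `f`. -/
def BRegular (D : Set E) : Prop :=
  ∀ f : E → ℝ, ContinuousOn f (frontier D) →
    ∃ F : E → ℝ, ContinuousOn F (closure D) ∧
      PshOn (fun z => ((F z : ℝ) : EReal)) D ∧ ∀ x ∈ frontier D, F x = f x

/-- The extremal function `ω₁(z, K, D)`, defined with continuous-up-to-the-boundary
plurisubharmonic competitors. -/
noncomputable def bndExtCont (z : E) (K D : Set E) : EReal :=
  sSup {w : EReal | ∃ F : E → ℝ, ContinuousOn F (closure D) ∧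
    PshOn (fun y => ((F y : ℝ) : EReal)) D ∧ (∀ y ∈ closure D, F y ≤ 0) ∧
    (∀ x ∈ K, F x ≤ -1) ∧ w = ((F z : ℝ) : EReal)}

end

noncomputable section

variable {E : Type*} [NormedAddCommGroup E] [NormedSpace ℂ E]

/-- The (affine) real tangent hyperplane to `∂D` at `ξ`, described by a defining
function `ρ` of the domain. -/
def tangentHyperplane (ρ : E → ℝ) (ξ : E) : Set E :=
  {w : E | fderiv ℝ ρ ξ (w - ξ) = 0}

/-- The Korányi–Stein approach region
`C_α(ξ) = {z ∈ D : |z - ξ| < α δ_ξ(z)}`, where `δ_ξ(z)` is the distance from `z`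
to the real tangent hyperplane to `∂D` at `ξ`. -/
def koranyiRegion (D : Set E) (ρ : E → ℝ) (α : ℝ) (ξ : E) : Set E :=
  {z ∈ D | dist z ξ < α * Metric.infDist z (tangentHyperplane ρ ξ)}

/-- `u^#(ξ) = sup_{α > 1} limsup_{z → ξ, z ∈ C_α(ξ)} u(z)`. -/
def sharpBoundaryValue (D : Set E) (ρ : E → ℝ) (u : E → EReal) (ξ : E) : EReal :=
  ⨆ (α : ℝ) (_ : 1 < α), Filter.limsup u (𝓝[koranyiRegion D ρ α ξ] ξ)

/-- The inward real normal at `ζ ∈ ∂D`: the points of `D` (distinct from `ζ`) for which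
the distance to the tangent hyperplane at `ζ` equals the distance to `ζ`, i.e. the points
of `D` lying on the real normal line to `∂D` at `ζ`. -/
def inwardNormal (D : Set E) (ρ : E → ℝ) (ζ : E) : Set E :=
  {z ∈ D | z ≠ ζ ∧ Metric.infDist z (tangentHyperplane ρ ζ) = dist z ζ}

/-- Sadullaev's extremal function `ω̃(z, K, D)`, with competitors whose Korányi–Stein
boundary values `u^#` are at most `-1` on `K`. -/
def bndExtSharp (D : Set E) (ρ : E → ℝ) (z : E) (K : Set E) : EReal :=
  sSup {w : EReal | ∃ u : E → EReal, MemPSH u D ∧ (∀ y ∈ D, u y ≤ 0) ∧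
    (∀ ξ ∈ K, sharpBoundaryValue D ρ u ξ ≤ -1) ∧ w = u z}

/-- Sadullaev's extremal function `ω₃(z, K, D)`, with competitors whose `limsup` along
the inward normal is at most `-1` at every point of `K`. -/
def bndExtNormal (D : Set E) (ρ : E → ℝ) (z : E) (K : Set E) : EReal :=
  sSup {w : EReal | ∃ u : E → EReal, MemPSH u D ∧ (∀ y ∈ D, u y ≤ 0) ∧
    (∀ ζ ∈ K, Filter.limsup u (𝓝[inwardNormal D ρ ζ] ζ) ≤ -1) ∧ w = u z}

end


namespace RH

abbrev EE (n : ℕ) := EuclideanSpace ℂ (Fin n)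
abbrev TT (n : ℕ) := Fin n → Circle

/-- torus action -/
def rot {n : ℕ} (g : TT n) (x : EE n) : EE n := WithLp.toLp 2 (fun j => (g j : ℂ) * x j)

@[simp] lemma rot_apply {n : ℕ} (g : TT n) (x : EE n) (j : Fin n) : rot g x j = (g j : ℂ) * x j := rfl

lemma rot_mul {n : ℕ} (g h : TT n) (x : EE n) : rot (g * h) x = rot g (rot h x) := by
  ext j; simp [mul_assoc]

lemma rot_one {n : ℕ} (x : EE n) : rot 1 x = x := by
  ext j; simp

lemma rot_add_smul {n : ℕ} (g : TT n) (a b : EE n) (ζ : ℂ) :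
    rot g (a + ζ • b) = rot g a + ζ • rot g b := by
  ext j; simp; ring

lemma rot_smul {n : ℕ} (g : TT n) (b : EE n) (ζ : ℂ) :
    rot g (ζ • b) = ζ • rot g b := by
  ext j; simp; ring

lemma rot_norm_apply {n : ℕ} (g : TT n) (x : EE n) (j : Fin n) : ‖rot g x j‖ = ‖x j‖ := by
  rw [rot_apply, norm_mul, Circle.norm_coe, one_mul]

lemma continuous_rot {n : ℕ} : Continuous (fun p : TT n × EE n => rot p.1 p.2) := by
  unfold rot
  refine (PiLp.continuous_toLp 2 _).comp (continuous_pi fun j => ?_)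
  have h1 : Continuous (fun p : TT n × EE n => ((p.1 j : Circle) : ℂ)) :=
    continuous_subtype_val.comp ((continuous_apply j).comp continuous_fst)
  have h2 : Continuous (fun p : TT n × EE n => p.2 j) := by fun_prop
  exact h1.mul h2

lemma continuous_rot_left {n : ℕ} (x : EE n) : Continuous (fun g : TT n => rot g x) :=
  continuous_rot.comp (by fun_prop : Continuous fun g : TT n => (g, x))

lemma continuous_rot_right {n : ℕ} (g : TT n) : Continuous (fun x : EE n => rot g x) :=
  continuous_rot.comp (by fun_prop : Continuous fun x : EE n => (g, x))

lemma exists_rot {n : ℕ} (x y : EE n) (h : ∀ j, ‖x j‖ = ‖y j‖) : ∃ g : TT n, x = rot g y := by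
  have : ∀ j, ∃ c : Circle, x j = c * y j := by
    intro j
    by_cases hy : y j = 0
    · refine ⟨1, ?_⟩
      have : x j = 0 := by rw [← norm_eq_zero, h, hy, norm_zero]
      simp [this, hy]
    · refine ⟨⟨x j / y j, ?_⟩, ?_⟩
      · have : ‖y j‖ ≠ 0 := by simpa using hy
        simp [Submonoid.unitSphere, h j, this]
      · simp [hy]
  choose g hg using this
  exact ⟨g, by ext j; simp [hg]⟩

structure Good {n : ℕ} (D : Set (EE n)) (M : ℝ) (V : EE n → ℝ) : Prop where
  meas : Measurable V
  out : ∀ x, x ∉ D → V x = 0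
  nn : ∀ x, 0 ≤ V x
  le : ∀ x, V x ≤ M
  usc : UpperSemicontinuousOn V D
  sub : ∀ a b : EE n, (∀ ζ : ℂ, ‖ζ‖ ≤ 1 → a + ζ • b ∈ D) →
    V a ≤ (2 * Real.pi)⁻¹ * ∫ φ in (0:ℝ)..(2 * Real.pi), V (a + Complex.exp (φ * Complex.I) • b)

lemma circ_cont {n : ℕ} (a b : EE n) :
    Continuous (fun φ : ℝ => a + Complex.exp (φ * Complex.I) • b) := by
  fun_prop

lemma bdd_intble {f : ℝ → ℝ} (hf : Measurable f) {M : ℝ} (h0 : ∀ x, 0 ≤ f x) (h1 : ∀ x, f x ≤ M)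
    (a b : ℝ) : IntervalIntegrable f volume a b := by
  rw [intervalIntegrable_iff]
  refine Measure.integrableOn_of_bounded (M := M) ?_ hf.aestronglyMeasurable ?_
  · simp
  · exact Filter.Eventually.of_forall fun x => by
      rw [Real.norm_eq_abs, abs_of_nonneg (h0 x)]; exact h1 x

lemma Good.intble {n : ℕ} {D : Set (EE n)} {M : ℝ} {V : EE n → ℝ} (h : Good D M V) (a b : EE n)
    (s t : ℝ) :
    IntervalIntegrable (fun φ : ℝ => V (a + Complex.exp (φ * Complex.I) • b)) volume s t :=
  bdd_intble (h.meas.comp (circ_cont a b).measurable) (fun _ => h.nn _) (fun _ => h.le _) s t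

lemma Good.le_avg {n : ℕ} {D : Set (EE n)} {M : ℝ} {V : EE n → ℝ} (h : Good D M V) (a b : EE n)
    (hab : ∀ ζ : ℂ, ‖ζ‖ ≤ 1 → a + ζ • b ∈ D) {f : ℝ → ℝ}
    (hf : IntervalIntegrable f volume 0 (2 * Real.pi))
    (hle : ∀ φ : ℝ, V (a + Complex.exp (φ * Complex.I) • b) ≤ f φ) :
    V a ≤ (2 * Real.pi)⁻¹ * ∫ φ in (0:ℝ)..(2 * Real.pi), f φ := by
  refine (h.sub a b hab).trans ?_
  refine mul_le_mul_of_nonneg_left ?_ (by positivity)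
  exact intervalIntegral.integral_mono_on (by positivity) (h.intble a b _ _) hf (fun x _ => hle x)

def Circ {n : ℕ} (V : EE n → ℝ) : Prop := ∀ (g : TT n) x, V (rot g x) = V x

def Compl {n : ℕ} (D : Set (EE n)) : Prop := ∀ z ∈ D, ∀ w : EE n, (∀ j, ‖w j‖ ≤ ‖z j‖) → w ∈ D

lemma isCompact_poly {n : ℕ} (y : EE n) : IsCompact {x : EE n | ∀ j, ‖x j‖ ≤ ‖y j‖} := by
  refine (isCompact_closedBall (0 : EE n) ‖y‖).of_isClosed_subset ?_ ?_
  · simp only [Set.ofPred_forall]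
    exact isClosed_iInter fun j => isClosed_le (by fun_prop) continuous_const
  · intro x hx
    rw [mem_closedBall_zero_iff, EuclideanSpace.norm_eq, EuclideanSpace.norm_eq]
    gcongr with j
    exact hx j

lemma norm_circ {n : ℕ} (a b : EE n) (φ : ℝ) :
    ‖a + Complex.exp (φ * Complex.I) • b‖ ^ 2 = ‖a‖ ^ 2 + ‖b‖ ^ 2
      + 2 * ((inner ℂ a b).re * Real.cos φ - (inner ℂ a b).im * Real.sin φ) := by
  rw [norm_add_sq (𝕜 := ℂ), inner_smul_right, norm_smul, Complex.norm_exp_ofReal_mul_I]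
  simp only [RCLike.re_to_complex, Complex.mul_re, Complex.exp_ofReal_mul_I_re,
    Complex.exp_ofReal_mul_I_im]
  ring

lemma Good.mono {n : ℕ} {D : Set (EE n)} {M : ℝ} {V : EE n → ℝ} (h : Good D M V) (hc : Circ V)
    (hD : Compl D) {x y : EE n} (hy : y ∈ D) (hxy : ∀ j, ‖x j‖ ≤ ‖y j‖) : V x ≤ V y := by
  have key : ∀ ε > 0, V x + ε * ‖x‖ ^ 2 ≤ V y + ε * ‖y‖ ^ 2 := by
    intro ε hε
    set P := {x : EE n | ∀ j, ‖x j‖ ≤ ‖y j‖} with hP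
    have hPD : P ⊆ D := fun z hz => hD y hy z hz
    have husc : UpperSemicontinuousOn (fun z => V z + ε * ‖z‖ ^ 2) P :=
      (h.usc.mono hPD).add (ContinuousOn.upperSemicontinuousOn (by fun_prop))
    have hyP : y ∈ P := fun j => le_rfl
    obtain ⟨m, hmP, hm⟩ := husc.exists_isMaxOn ⟨y, hyP⟩ (isCompact_poly y)
    have hm' : ∀ z ∈ P, V z + ε * ‖z‖ ^ 2 ≤ V m + ε * ‖m‖ ^ 2 := fun z hz => hm hz
    have heq : ∀ j, ‖m j‖ = ‖y j‖ := by
      by_contra hne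
      push Not at hne
      obtain ⟨j, hj⟩ := hne
      have hs : 0 < ‖y j‖ - ‖m j‖ := sub_pos.2 (lt_of_le_of_ne (hmP j) hj)
      set s := ‖y j‖ - ‖m j‖ with hsdef
      set b : EE n := EuclideanSpace.single j (s : ℂ) with hb
      have hnb : ‖b‖ = s := by simp [hb, abs_of_pos hs]
      have hin : ∀ ζ : ℂ, ‖ζ‖ ≤ 1 → m + ζ • b ∈ P := by
        intro ζ hζ i
        by_cases hij : i = j
        · subst hij
          have : ‖m i + ζ * s‖ ≤ ‖m i‖ + 1 * s := by
            refine (norm_add_le _ _).trans ?_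
            rw [norm_mul, Complex.norm_real, Real.norm_eq_abs, abs_of_pos hs]
            gcongr
          simp [hb]
          linarith
        · simpa [hb, hij] using hmP i
      have hinteg : IntervalIntegrable (fun φ : ℝ => V m + ε * ‖m‖ ^ 2 - ε * (‖m‖ ^ 2 + ‖b‖ ^ 2
          + 2 * ((inner ℂ m b).re * Real.cos φ - (inner ℂ m b).im * Real.sin φ)))
          volume 0 (2 * Real.pi) := Continuous.intervalIntegrable (by fun_prop) _ _
      have h1 := h.le_avg m b (fun ζ hζ => hPD (hin ζ hζ)) hinteg (by
        intro φ
        have := hm' _ (hin (Complex.exp (φ * Complex.I)) (by simp [Complex.norm_exp_ofReal_mul_I]))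
        rw [norm_circ] at this
        linarith)
      have h2 : ∫ φ in (0:ℝ)..(2 * Real.pi), (V m + ε * ‖m‖ ^ 2 - ε * (‖m‖ ^ 2 + ‖b‖ ^ 2
          + 2 * ((inner ℂ m b).re * Real.cos φ - (inner ℂ m b).im * Real.sin φ)))
          = 2 * Real.pi * (V m - ε * s ^ 2) := by
        have e : ∀ φ : ℝ, (V m + ε * ‖m‖ ^ 2 - ε * (‖m‖ ^ 2 + ‖b‖ ^ 2
          + 2 * ((inner ℂ m b).re * Real.cos φ - (inner ℂ m b).im * Real.sin φ)))
          = (V m - ε * s ^ 2) + ((-2 * ε * (inner ℂ m b).re) * Real.cos φ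
            + (2 * ε * (inner ℂ m b).im) * Real.sin φ) := by
          intro φ; rw [hnb]; ring
        simp_rw [e]
        rw [intervalIntegral.integral_add (Continuous.intervalIntegrable (by fun_prop) _ _)
          (Continuous.intervalIntegrable (by fun_prop) _ _),
          intervalIntegral.integral_add (Continuous.intervalIntegrable (by fun_prop) _ _)
          (Continuous.intervalIntegrable (by fun_prop) _ _)]
        simp
        ring
      rw [h2] at h1
      have : (2 * Real.pi)⁻¹ * (2 * Real.pi * (V m - ε * s ^ 2)) = V m - ε * s ^ 2 := by
        field_simp
      rw [this] at h1
      have : 0 < ε * s ^ 2 := by positivity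
      linarith
    obtain ⟨g, hg⟩ := exists_rot m y heq
    have h3 := hm' x hxy
    have h4 : ‖m‖ = ‖y‖ := by
      rw [EuclideanSpace.norm_eq, EuclideanSpace.norm_eq]; simp [heq]
    rw [h4, hg, hc] at h3
    exact h3
  have hlim : Tendsto (fun ε : ℝ => V y + ε * ‖y‖ ^ 2 - ε * ‖x‖ ^ 2) (𝓝[>] 0) (𝓝 (V y)) := by
    have : Continuous (fun ε : ℝ => V y + ε * ‖y‖ ^ 2 - ε * ‖x‖ ^ 2) := by fun_prop
    have := this.tendsto 0
    simp at this
    exact this.mono_left nhdsWithin_le_nhds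
  refine ge_of_tendsto hlim ?_
  filter_upwards [self_mem_nhdsWithin] with ε hε
  have := key ε hε
  linarith

lemma meas_of_usc {n : ℕ} {D : Set (EE n)} (hDo : IsOpen D) {V : EE n → ℝ}
    (out : ∀ x, x ∉ D → V x = 0) (nn : ∀ x, 0 ≤ V x)
    (usc : UpperSemicontinuousOn V D) : Measurable V := by
  refine measurable_of_Iio fun c => ?_
  by_cases hc : 0 < c
  · have ho : IsOpen {x | x ∈ D ∧ V x < c} := by
      rw [isOpen_iff_mem_nhds]
      rintro x ⟨hx, hxc⟩
      have := usc x hx c hxc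
      rw [hDo.nhdsWithin_eq hx] at this
      exact Filter.inter_mem (hDo.mem_nhds hx) this
    have : V ⁻¹' Iio c = Dᶜ ∪ {x | x ∈ D ∧ V x < c} := by
      ext x
      by_cases hx : x ∈ D
      · simp [hx]
      · simp [hx, out x hx, hc]
    rw [this]
    exact hDo.measurableSet.compl.union ho.measurableSet
  · have : V ⁻¹' Iio c = ∅ := by
      ext x
      simp
      have := nn x
      linarith
    rw [this]
    exact MeasurableSet.empty

lemma Good.left {n : ℕ} {D : Set (EE n)} {M : ℝ} {V : EE n → ℝ} (h : Good D M V) (hc : Circ V)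
    (hD : Compl D) (hDo : IsOpen D) {z : EE n} (hz : z ∈ D) {ε : ℝ} (hε : 0 < ε) :
    ∃ r : ℝ, 0 < r ∧ r < 1 ∧ V z ≤ V ((r : ℂ) • z) + ε := by
  have hcont : Tendsto (fun δ : ℝ => ((1 + δ : ℝ) : ℂ) • z) (𝓝[>] 0) (𝓝 z) := by
    have : Continuous (fun δ : ℝ => ((1 + δ : ℝ) : ℂ) • z) := by fun_prop
    have := this.tendsto 0
    simp at this
    simpa using this.mono_left nhdsWithin_le_nhds
  have h1 := hcont.eventually (hDo.mem_nhds hz)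
  have h2 := h.usc z hz (V z + ε / 2) (by linarith)
  rw [hDo.nhdsWithin_eq hz] at h2
  have h2 := hcont.eventually h2
  have h3 : ∀ᶠ δ : ℝ in 𝓝[>] 0, δ < 1 / 2 :=
    (tendsto_id.mono_left nhdsWithin_le_nhds).eventually (gt_mem_nhds (by norm_num))
  obtain ⟨δ, ⟨⟨h1, h2⟩, h3⟩, h0⟩ := (((h1.and h2).and h3).and self_mem_nhdsWithin).exists
  have h0 : 0 < δ := h0
  have hq : 0 < 1 - δ + δ ^ 2 := by nlinarith
  have hq1 : 1 - δ + δ ^ 2 < 1 := by nlinarith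
  set r := Real.sqrt (1 - δ + δ ^ 2) with hr
  have hr0 : 0 < r := Real.sqrt_pos.2 hq
  have hr1 : r < 1 := by rw [hr, Real.sqrt_lt' one_pos]; simpa using hq1
  have hrz : (r : ℂ) • z ∈ D := by
    refine hD z hz _ fun j => ?_
    simp only [PiLp.smul_apply, smul_eq_mul, norm_mul, Complex.norm_real, Real.norm_eq_abs,
      abs_of_pos hr0]
    exact mul_le_of_le_one_left (norm_nonneg _) hr1.le
  refine ⟨r, hr0, hr1, ?_⟩
  set b : EE n := (δ : ℂ) • z with hb
  have hcoord : ∀ (ζ : ℂ) j, ‖(z + ζ • b) j‖ = ‖1 + ζ * δ‖ * ‖z j‖ := by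
    intro ζ j
    rw [← norm_mul]
    simp only [hb, PiLp.add_apply, PiLp.smul_apply, smul_eq_mul]
    congr 1; ring
  have hup : ∀ (ζ : ℂ), ‖ζ‖ ≤ 1 → ∀ j, ‖(z + ζ • b) j‖ ≤ ‖(((1 + δ : ℝ) : ℂ) • z) j‖ := by
    intro ζ hζ j
    rw [hcoord]
    simp only [PiLp.smul_apply, smul_eq_mul, norm_mul]
    gcongr
    refine (norm_add_le _ _).trans ?_
    rw [norm_mul, Complex.norm_real, Complex.norm_real, Real.norm_eq_abs, Real.norm_eq_abs,
      abs_of_pos h0, abs_of_pos (by linarith), norm_one]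
    nlinarith
  have hsub := h.sub z b (fun ζ hζ => hD _ h1 _ (hup ζ hζ))
  have hB : ∀ φ : ℝ, V (z + Complex.exp (φ * Complex.I) • b) ≤ V z + ε / 2 := fun φ =>
    (h.mono hc hD h1 (hup _ (by rw [Complex.norm_exp_ofReal_mul_I]))).trans h2.le
  have hL : ∀ φ : ℝ, φ ∈ Icc (2 * Real.pi / 3) (4 * Real.pi / 3) →
      V (z + Complex.exp (φ * Complex.I) • b) ≤ V ((r : ℂ) • z) := by
    intro φ hφ
    refine h.mono hc hD hrz fun j => ?_
    rw [hcoord]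
    simp only [PiLp.smul_apply, smul_eq_mul, norm_mul, Complex.norm_real, Real.norm_eq_abs,
      abs_of_pos hr0]
    gcongr
    rw [hr]
    apply Real.le_sqrt_of_sq_le
    have hcos : Real.cos φ ≤ -1 / 2 := by
      have e : Real.cos φ = - Real.cos |φ - Real.pi| := by
        rw [Real.cos_abs, Real.cos_sub_pi]; ring
      have : Real.cos (Real.pi / 3) ≤ Real.cos |φ - Real.pi| := by
        apply Real.cos_le_cos_of_nonneg_of_le_pi (abs_nonneg _)
        · linarith [Real.pi_pos]
        · rw [abs_le]; constructor <;> linarith [hφ.1, hφ.2]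
      rw [Real.cos_pi_div_three] at this
      linarith
    rw [← Complex.normSq_eq_norm_sq, Complex.normSq_apply]
    simp only [Complex.add_re, Complex.add_im, Complex.one_re, Complex.one_im, Complex.mul_re,
      Complex.mul_im, Complex.ofReal_re, Complex.ofReal_im, Complex.exp_ofReal_mul_I_re,
      Complex.exp_ofReal_mul_I_im]
    have := Real.sin_sq_add_cos_sq φ
    nlinarith
  have hpi := Real.pi_pos
  have hI := fun s t => h.intble z b s t
  have hsplit : (∫ φ in (0:ℝ)..(2 * Real.pi), V (z + Complex.exp (φ * Complex.I) • b))
      = (∫ φ in (0:ℝ)..(2 * Real.pi / 3), V (z + Complex.exp (φ * Complex.I) • b))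
      + (∫ φ in (2 * Real.pi / 3)..(4 * Real.pi / 3), V (z + Complex.exp (φ * Complex.I) • b))
      + (∫ φ in (4 * Real.pi / 3)..(2 * Real.pi), V (z + Complex.exp (φ * Complex.I) • b)) := by
    rw [intervalIntegral.integral_add_adjacent_intervals (hI _ _) (hI _ _),
      intervalIntegral.integral_add_adjacent_intervals (hI _ _) (hI _ _)]
  have i1 := intervalIntegral.integral_mono_on (μ := volume) (a := 0) (b := 2 * Real.pi / 3)
    (by positivity) (hI _ _) (intervalIntegrable_const (c := V z + ε / 2)) (fun x _ => hB x)
  have i2 := intervalIntegral.integral_mono_on (μ := volume) (a := 2 * Real.pi / 3)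
    (b := 4 * Real.pi / 3)
    (by linarith) (hI _ _) (intervalIntegrable_const (c := V ((r : ℂ) • z))) (fun x hx => hL x hx)
  have i3 := intervalIntegral.integral_mono_on (μ := volume) (a := 4 * Real.pi / 3)
    (b := 2 * Real.pi)
    (by linarith) (hI _ _) (intervalIntegrable_const (c := V z + ε / 2)) (fun x _ => hB x)
  rw [intervalIntegral.integral_const, smul_eq_mul] at i1 i2 i3
  have h5 : 2 * Real.pi * V z ≤ 2 * Real.pi / 3 * (2 * (V z + ε / 2) + V ((r : ℂ) • z)) := by
    have : 2 * Real.pi * V z ≤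
        ∫ φ in (0:ℝ)..(2 * Real.pi), V (z + Complex.exp (φ * Complex.I) • b) := by
      have := mul_le_mul_of_nonneg_left hsub (by positivity : 0 ≤ 2 * Real.pi)
      rwa [← mul_assoc, mul_inv_cancel₀ (by positivity), one_mul] at this
    rw [hsplit] at this
    linarith
  have h6 : V z ≤ (2 * (V z + ε / 2) + V ((r : ℂ) • z)) / 3 := by
    have h7 : 2 * Real.pi * V z ≤ 2 * Real.pi * ((2 * (V z + ε / 2) + V ((r : ℂ) • z)) / 3) := by
      linarith
    exact le_of_mul_le_mul_left h7 (by positivity)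
  linarith

lemma Good.cont {n : ℕ} {D : Set (EE n)} {M : ℝ} {V : EE n → ℝ} (h : Good D M V) (hc : Circ V)
    (hD : Compl D) (hDo : IsOpen D) : ContinuousOn V D := by
  intro z hz
  rw [ContinuousWithinAt, tendsto_order]
  refine ⟨fun c hcz => ?_, fun c hcz => h.usc z hz c hcz⟩
  obtain ⟨r, hr0, hr1, hr⟩ := h.left hc hD hDo hz (ε := (V z - c) / 2) (by linarith)
  have hev : ∀ j, ∀ᶠ x in 𝓝[D] z, ‖((r : ℂ) • z) j‖ ≤ ‖x j‖ := by
    intro j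
    have e : ‖((r : ℂ) • z) j‖ = r * ‖z j‖ := by
      simp [abs_of_pos hr0]
    rw [e]
    by_cases hj : z j = 0
    · simp [hj]
    · have hlt : r * ‖z j‖ < ‖z j‖ := mul_lt_of_lt_one_left (norm_pos_iff.2 hj) hr1
      have hcn : Continuous (fun x : EE n => ‖x j‖) := by fun_prop
      have := (hcn.tendsto z).eventually (lt_mem_nhds hlt)
      filter_upwards [nhdsWithin_le_nhds this] with x hx using hx.le
  filter_upwards [Filter.eventually_all.2 hev, self_mem_nhdsWithin] with x hx hxD
  have := h.mono hc hD hxD hx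
  linarith

lemma Compl.rot {n : ℕ} {D : Set (EE n)} (hD : Compl D) (g : TT n) {x : EE n} (hx : x ∈ D) :
    RH.rot g x ∈ D := hD x hx _ fun j => (rot_norm_apply g x j).le

lemma Compl.rot' {n : ℕ} {D : Set (EE n)} (hD : Compl D) (g : TT n) {x : EE n} (hx : x ∉ D) :
    RH.rot g x ∉ D := fun h => hx (hD _ h _ fun j => (rot_norm_apply g x j).ge)

lemma Good.bddAbove {n : ℕ} {D : Set (EE n)} {M : ℝ} {V : EE n → ℝ} (h : Good D M V) (x : EE n) :
    BddAbove (Set.range fun g : TT n => V (rot g x)) :=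
  ⟨M, by rintro _ ⟨g, rfl⟩; exact h.le _⟩

lemma Good.sup {n : ℕ} {D : Set (EE n)} {M : ℝ} {V : EE n → ℝ} (h : Good D M V)
    (hD : Compl D) (hDo : IsOpen D) : Good D M (fun x => ⨆ g : TT n, V (rot g x)) := by
  have hout : ∀ x, x ∉ D → (⨆ g : TT n, V (rot g x)) = 0 := by
    intro x hx
    simp [h.out _ (hD.rot' _ hx)]
  have hnn : ∀ x, 0 ≤ (⨆ g : TT n, V (rot g x)) := fun x => Real.iSup_nonneg fun g => h.nn _
  have hle : ∀ x, (⨆ g : TT n, V (rot g x)) ≤ M := fun x => ciSup_le fun g => h.le _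
  have husc : UpperSemicontinuousOn (fun x => ⨆ g : TT n, V (rot g x)) D := by
    intro z hz y hy
    obtain ⟨y', hy1, hy2⟩ := exists_between hy
    have : ∀ᶠ x in 𝓝 z, ∀ g ∈ (Set.univ : Set (TT n)), V (rot g x) < y' := by
      refine IsCompact.eventually_forall_of_forall_eventually isCompact_univ fun g _ => ?_
      have h1 : V (rot g z) < y' := (le_ciSup (h.bddAbove z) g).trans_lt hy1
      have h2 := h.usc _ (hD.rot g hz) y' h1
      rw [hDo.nhdsWithin_eq (hD.rot g hz)] at h2
      have hc : Continuous (fun p : EE n × TT n => rot p.2 p.1) :=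
        continuous_rot.comp continuous_swap
      exact (hc.tendsto (z, g)).eventually h2
    filter_upwards [nhdsWithin_le_nhds this] with x hx
    exact (ciSup_le fun g => (hx g trivial).le).trans_lt hy2
  have hmeas := meas_of_usc hDo hout hnn husc
  refine ⟨hmeas, hout, hnn, hle, husc, ?_⟩
  intro a b hab
  refine ciSup_le fun g => ?_
  refine h.le_avg (rot g a) (rot g b) (fun ζ hζ => ?_) ?_ ?_
  · rw [← rot_add_smul]; exact hD.rot g (hab ζ hζ)
  · exact bdd_intble (hmeas.comp (circ_cont a b).measurable) (fun _ => hnn _) (fun _ => hle _) _ _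
  · intro φ
    rw [← rot_add_smul]
    exact le_ciSup (h.bddAbove _) g

lemma circ_sup {n : ℕ} (V : EE n → ℝ) : Circ (fun x => ⨆ g : TT n, V (rot g x)) := by
  intro h x
  simp only [← rot_mul]
  exact (Equiv.mulRight h).iSup_comp (g := fun g => V (rot g x))

noncomputable instance instMeasCircle : MeasurableSpace Circle := borel Circle
instance instBorelCircle : BorelSpace Circle := ⟨rfl⟩

/-- normalized Haar measure on the torus -/
noncomputable def haarT (n : ℕ) : Measure (TT n) := Measure.haarMeasure ⊤

instance instProbHaar (n : ℕ) : IsProbabilityMeasure (haarT n) :=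
  ⟨by simpa [haarT] using Measure.haarMeasure_self (K₀ := (⊤ : TopologicalSpace.PositiveCompacts (TT n)))⟩

instance instInvHaar (n : ℕ) : (haarT n).IsMulLeftInvariant := by unfold haarT; infer_instance

lemma bdd_integrable {α : Type*} [MeasurableSpace α] (μ : Measure α) [IsFiniteMeasure μ]
    {f : α → ℝ} (hf : Measurable f) {M : ℝ} (h0 : ∀ x, 0 ≤ f x) (h1 : ∀ x, f x ≤ M) :
    Integrable f μ :=
  Integrable.of_bound hf.aestronglyMeasurable M (Filter.Eventually.of_forall fun x => by
      rw [Real.norm_eq_abs, abs_of_nonneg (h0 x)]; exact h1 x)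

noncomputable def avg {n : ℕ} (V : EE n → ℝ) (x : EE n) : ℝ := ∫ g, V (rot g x) ∂(haarT n)

lemma circ_avg {n : ℕ} (V : EE n → ℝ) : Circ (avg V) := by
  intro h x
  unfold avg
  simp only [← rot_mul]
  simp only [mul_comm _ h]
  exact integral_mul_left_eq_self (fun g => V (rot g x)) h

lemma Good.meas_rot {n : ℕ} {D : Set (EE n)} {M : ℝ} {V : EE n → ℝ} (h : Good D M V) (x : EE n) :
    Measurable (fun g : TT n => V (rot g x)) := h.meas.comp (continuous_rot_left x).measurable

lemma Good.int_rot {n : ℕ} {D : Set (EE n)} {M : ℝ} {V : EE n → ℝ} (h : Good D M V) (x : EE n) :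
    Integrable (fun g : TT n => V (rot g x)) (haarT n) :=
  bdd_integrable _ (h.meas_rot x) (fun _ => h.nn _) (fun _ => h.le _)

lemma Good.avg_usc {n : ℕ} {D : Set (EE n)} {M : ℝ} {V : EE n → ℝ} (h : Good D M V)
    (hD : Compl D) (hDo : IsOpen D) : UpperSemicontinuousOn (avg V) D := by
  intro z hz y hy
  by_contra hcon
  rw [hDo.nhdsWithin_eq hz] at hcon
  have hfr : ∃ᶠ x in 𝓝 z, y ≤ avg V x := by
    rw [Filter.not_eventually] at hcon
    exact hcon.mono fun x hx => not_lt.1 hx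
  obtain ⟨x, hx, hxy⟩ := Filter.exists_seq_forall_of_frequently hfr
  have e : ∀ x, ENNReal.ofReal (avg V x) = ∫⁻ g, ENNReal.ofReal (V (rot g x)) ∂(haarT n) := fun x =>
    ofReal_integral_eq_lintegral_ofReal (h.int_rot x) (Filter.Eventually.of_forall fun _ => h.nn _)
  have h1 := limsup_lintegral_le (μ := haarT n) (f := fun k g => ENNReal.ofReal (V (rot g (x k))))
    (fun _ => ENNReal.ofReal M) (fun k => (h.meas_rot _).ennreal_ofReal)
    (fun k => Filter.Eventually.of_forall fun g => ENNReal.ofReal_le_ofReal (h.le _))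
    (by simp)
  have h2 : ∫⁻ g, limsup (fun k => ENNReal.ofReal (V (rot g (x k)))) atTop ∂(haarT n)
      ≤ ∫⁻ g, ENNReal.ofReal (V (rot g z)) ∂(haarT n) := by
    refine lintegral_mono fun g => ?_
    refine le_of_forall_gt_imp_ge_of_dense fun c hc => ?_
    by_cases hct : c = ⊤
    · simp [hct]
    have hlt : V (rot g z) < c.toReal := (ENNReal.ofReal_lt_iff_lt_toReal (h.nn _) hct).1 hc
    have h3 := h.usc _ (hD.rot g hz) _ hlt
    rw [hDo.nhdsWithin_eq (hD.rot g hz)] at h3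
    have h4 := (((continuous_rot_right g).tendsto z).comp hx).eventually h3
    refine limsup_le_of_le (by isBoundedDefault) (h4.mono fun k hk => ?_)
    exact ENNReal.ofReal_le_of_le_toReal (le_of_lt hk)
  simp only [← e] at h1 h2
  have h3 : ENNReal.ofReal y ≤ limsup (fun k => ENNReal.ofReal (avg V (x k))) atTop :=
    le_limsup_of_frequently_le (Filter.Frequently.of_forall fun k =>
      ENNReal.ofReal_le_ofReal (hxy k)) (by isBoundedDefault)
  have h4 := h3.trans (h1.trans h2)
  have h0 : 0 ≤ avg V z := integral_nonneg fun _ => h.nn _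
  exact absurd ((ENNReal.ofReal_le_ofReal_iff h0).1 h4) (not_le.2 hy)

lemma Good.avg {n : ℕ} {D : Set (EE n)} {M : ℝ} {V : EE n → ℝ} (h : Good D M V)
    (hD : Compl D) (hDo : IsOpen D) : Good D M (avg V) := by
  have hout : ∀ x, x ∉ D → RH.avg V x = 0 := by
    intro x hx
    simp [RH.avg, h.out _ (hD.rot' _ hx)]
  have hnn : ∀ x, 0 ≤ RH.avg V x := fun x => integral_nonneg fun g => h.nn _
  have hle : ∀ x, RH.avg V x ≤ M := fun x => by
    have := integral_mono (h.int_rot x) (integrable_const M) (fun g => h.le _)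
    simpa [RH.avg] using this
  have husc := h.avg_usc hD hDo
  refine ⟨meas_of_usc hDo hout hnn husc, hout, hnn, hle, husc, ?_⟩
  intro a b hab
  set F : TT n → ℝ → ℝ := fun g φ => V (rot g (a + Complex.exp (φ * Complex.I) • b)) with hF
  have hFm : Measurable (Function.uncurry F) := by
    have : Continuous (fun p : TT n × ℝ => rot p.1 (a + Complex.exp (p.2 * Complex.I) • b)) :=
      continuous_rot.comp (by fun_prop :
        Continuous fun p : TT n × ℝ => (p.1, a + Complex.exp (p.2 * Complex.I) • b))
    exact h.meas.comp this.measurable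
  have hswap : ∫ g, (∫ φ in (0:ℝ)..(2 * Real.pi), F g φ) ∂(haarT n)
      = ∫ φ in (0:ℝ)..(2 * Real.pi), (∫ g, F g φ ∂(haarT n)) := by
    simp only [intervalIntegral.integral_of_le Real.two_pi_pos.le]
    refine integral_integral_swap ?_
    exact bdd_integrable _ hFm (fun _ => h.nn _) (fun _ => h.le _)
  have hinteg : Integrable (fun g => ∫ φ in (0:ℝ)..(2 * Real.pi), F g φ) (haarT n) := by
    simp only [intervalIntegral.integral_of_le Real.two_pi_pos.le]
    have : Integrable (Function.uncurry F)
        ((haarT n).prod (volume.restrict (Ioc 0 (2 * Real.pi)))) :=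
      bdd_integrable _ hFm (fun _ => h.nn _) (fun _ => h.le _)
    exact this.integral_prod_left
  have h1 : RH.avg V a ≤ ∫ g, (2 * Real.pi)⁻¹ * (∫ φ in (0:ℝ)..(2 * Real.pi), F g φ) ∂(haarT n) := by
    refine integral_mono (h.int_rot a) (hinteg.const_mul _) fun g => ?_
    have := h.sub (rot g a) (rot g b) (fun ζ hζ => by
      rw [← rot_add_smul]; exact hD.rot g (hab ζ hζ))
    simpa only [hF, rot_add_smul] using this
  rw [integral_const_mul, hswap] at h1
  exact h1

/-- real-linear equivalence: rotation -/
noncomputable def rotL {n : ℕ} (g : TT n) : EE n ≃ₗ[ℝ] EE n where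
  toFun := rot g
  invFun := rot g⁻¹
  left_inv x := by rw [← rot_mul]; simp [rot_one]
  right_inv x := by rw [← rot_mul]; simp [rot_one]
  map_add' x y := by ext j; simp [mul_add]
  map_smul' c x := by ext j; simp; ring

/-- real-linear equivalence: scalar circle multiplication -/
noncomputable def mulL (n : ℕ) (c : ℂ) (hc : c ≠ 0) : EE n ≃ₗ[ℝ] EE n where
  toFun x := c • x
  invFun x := c⁻¹ • x
  left_inv x := by simp [smul_smul, hc]
  right_inv x := by simp [smul_smul, hc]
  map_add' x y := by simp
  map_smul' r x := by ext j; simp; ring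

lemma null_preimage {n : ℕ} (f : EE n ≃ₗ[ℝ] EE n) {N : Set (EE n)}
    (hN : (Measure.addHaar : Measure (EE n)) N = 0) :
    (Measure.addHaar : Measure (EE n)) (f ⁻¹' N) = 0 := by
  rw [Measure.addHaar_preimage_linearEquiv, hN, mul_zero]

/-- If torus averages vanish on an open torus-invariant set, the function vanishes there. -/
lemma Good.zero {n : ℕ} {D : Set (EE n)} {M : ℝ} {V : EE n → ℝ} (h : Good D M V)
    {P : Set (EE n)} (hPo : IsOpen P) (hPD : P ⊆ D) (hPc : Compl P)
    (hA : ∀ x ∈ P, RH.avg V x = 0) {z : EE n} (hz : z ∈ P) : V z = 0 := by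
  set μ : Measure (EE n) := Measure.addHaar with hμ
  set N : Set (EE n) := P ∩ {x | V x ≠ 0} with hN
  have hNm : MeasurableSet N := hPo.measurableSet.inter (h.meas (measurableSet_singleton 0).compl)
  -- step 1 : N is null
  have hN0 : μ N = 0 := by
    have hm : MeasurableSet {p : EE n × TT n | rot p.2 p.1 ∈ N} :=
      (continuous_rot.comp continuous_swap).measurable hNm
    have h1 : (μ.prod (haarT n)) {p : EE n × TT n | rot p.2 p.1 ∈ N} = 0 := by
      refine Measure.measure_prod_null_of_ae_null hm (Filter.Eventually.of_forall fun x => ?_)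
      by_cases hx : x ∈ P
      · have h2 := (integral_eq_zero_iff_of_nonneg (fun g => h.nn (rot g x)) (h.int_rot x)).1 (hA x hx)
        rw [Filter.EventuallyEq, ae_iff] at h2
        refine measure_mono_null ?_ h2
        intro g hg
        exact hg.2
      · have : (Prod.mk x ⁻¹' {p : EE n × TT n | rot p.2 p.1 ∈ N}) = ∅ := by
          ext g
          simp only [mem_preimage, Set.mem_ofPred_eq, mem_empty_iff_false, iff_false]
          exact fun hg => hPc.rot' g hx hg.1
        simp [this]
    rw [← Measure.prod_swap, Measure.map_apply measurable_swap hm] at h1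
    have h3 := Measure.measure_ae_null_of_prod_null h1
    obtain ⟨g, hg⟩ := h3.exists
    have h4 : μ ((rotL g) ⁻¹' N) = 0 := hg
    have h5 := null_preimage (rotL g).symm h4
    have h6 : (rotL g).symm ⁻¹' ((rotL g) ⁻¹' N) = N := by
      ext x
      simp only [mem_preimage, LinearEquiv.apply_symm_apply]
    rwa [h6] at h5
  -- step 2
  obtain ⟨δ, hδ, hball⟩ := Metric.isOpen_iff.1 hPo z hz
  set ν : Measure ℝ := volume.restrict (Ioc 0 (2 * Real.pi)) with hν
  set S : Set (ℝ × EE n) := {p | z + Complex.exp (p.1 * Complex.I) • p.2 ∈ N} with hS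
  have hSm : MeasurableSet S := by
    have : Continuous (fun p : ℝ × EE n => z + Complex.exp (p.1 * Complex.I) • p.2) := by fun_prop
    exact this.measurable hNm
  have hS0 : (ν.prod μ) S = 0 := by
    refine Measure.measure_prod_null_of_ae_null hSm (Filter.Eventually.of_forall fun φ => ?_)
    have h6 : μ ((fun x => z + x) ⁻¹' N) = 0 := by rw [measure_preimage_add, hN0]
    have h7 := null_preimage (mulL n (Complex.exp (φ * Complex.I)) (Complex.exp_ne_zero _)) h6
    have h8 : (mulL n (Complex.exp (φ * Complex.I)) (Complex.exp_ne_zero _)) ⁻¹'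
        ((fun x => z + x) ⁻¹' N) = Prod.mk φ ⁻¹' S := by
      ext x
      simp only [mem_preimage, hS, Set.mem_ofPred_eq, mulL, LinearEquiv.coe_mk, LinearMap.coe_mk,
        AddHom.coe_mk]
    rw [h8] at h7
    simpa using h7
  have h7 : (μ.prod ν) (Prod.swap ⁻¹' S) = 0 := by
    rw [← Measure.map_apply measurable_swap hSm, Measure.prod_swap, hS0]
  have h8 := Measure.measure_ae_null_of_prod_null h7
  have hex : ∃ b ∈ ball (0 : EE n) δ, ν (Prod.mk b ⁻¹' (Prod.swap ⁻¹' S)) = 0 := by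
    by_contra hcon
    push Not at hcon
    have : μ (ball (0 : EE n) δ) = 0 := measure_mono_null (fun b hb => hcon b hb) h8
    exact absurd this (Metric.measure_ball_pos μ 0 hδ).ne'
  obtain ⟨b, hb, hb0⟩ := hex
  have hin : ∀ ζ : ℂ, ‖ζ‖ ≤ 1 → z + ζ • b ∈ P := by
    intro ζ hζ
    apply hball
    rw [mem_ball_zero_iff] at hb
    rw [mem_ball, dist_eq_norm, add_sub_cancel_left, norm_smul]
    nlinarith [norm_nonneg b]
  have h9 := h.sub z b (fun ζ hζ => hPD (hin ζ hζ))
  have h10 : ∫ φ in (0:ℝ)..(2 * Real.pi), V (z + Complex.exp (φ * Complex.I) • b) = 0 := by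
    rw [intervalIntegral.integral_of_le Real.two_pi_pos.le]
    refine integral_eq_zero_of_ae ?_
    rw [Filter.EventuallyEq, ae_iff]
    refine measure_mono_null ?_ hb0
    intro φ hφ
    exact ⟨hin _ (by rw [Complex.norm_exp_ofReal_mul_I]), hφ⟩
  rw [h10, mul_zero] at h9
  exact le_antisymm h9 (h.nn z)

open Classical in
/-- truncation of `u` -/
noncomputable def tr {n : ℕ} (D : Set (EE n)) (u : EE n → EReal) (x : EE n) : ℝ :=
  if x ∈ D then (max (u x) ((-((1 : ℕ) : ℝ) : ℝ) : EReal)).toReal + 1 else 0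

lemma coe_trunc {a : EReal} (h : a ≤ 0) :
    (((max a ((-((1 : ℕ) : ℝ) : ℝ) : EReal)).toReal : ℝ) : EReal)
      = max a ((-((1 : ℕ) : ℝ) : ℝ) : EReal) := by
  refine EReal.coe_toReal ?_ ?_
  · refine ne_of_lt (max_lt (h.trans_lt EReal.zero_lt_top) (EReal.coe_lt_top _))
  · exact ne_of_gt (lt_max_of_lt_right (EReal.bot_lt_coe _))

lemma tr_coe {n : ℕ} {D : Set (EE n)} {u : EE n → EReal} (hu0 : ∀ y ∈ D, u y ≤ 0) {x : EE n}
    (hx : x ∈ D) : ((tr D u x - 1 : ℝ) : EReal) = max (u x) ((-1 : ℝ) : EReal) := by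
  have := coe_trunc (hu0 x hx)
  simp only [tr, hx, if_true, add_sub_cancel_right]
  rw [this]; simp

lemma tr_lt {n : ℕ} {D : Set (EE n)} {u : EE n → EReal} (hu0 : ∀ y ∈ D, u y ≤ 0) {x : EE n}
    (hx : x ∈ D) {y : ℝ} : tr D u x < y ↔ u x < ((y - 1 : ℝ) : EReal) ∧ 0 < y := by
  have h : tr D u x < y ↔ ((tr D u x - 1 : ℝ) : EReal) < ((y - 1 : ℝ) : EReal) := by
    rw [EReal.coe_lt_coe_iff]; constructor <;> intro h <;> linarith
  rw [h, tr_coe hu0 hx, max_lt_iff, EReal.coe_lt_coe_iff]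
  constructor <;> rintro ⟨h1, h2⟩ <;> exact ⟨h1, by linarith⟩

lemma tr_good {n : ℕ} {D : Set (EE n)} (hDo : IsOpen D) {u : EE n → EReal} (hu : PshOn u D)
    (hu0 : ∀ y ∈ D, u y ≤ 0) : Good D 1 (tr D u) := by
  have hout : ∀ x, x ∉ D → tr D u x = 0 := fun x hx => by simp [tr, hx]
  have hnn : ∀ x, 0 ≤ tr D u x := by
    intro x
    by_cases hx : x ∈ D
    · by_contra hcon
      exact absurd ((tr_lt hu0 hx).1 (not_le.1 hcon)).2 (lt_irrefl _)
    · rw [hout x hx]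
  have hle : ∀ x, tr D u x ≤ 1 := by
    intro x
    by_cases hx : x ∈ D
    · have h1 := tr_coe hu0 hx
      have : ((tr D u x - 1 : ℝ) : EReal) ≤ ((0 : ℝ) : EReal) := by
        rw [h1]
        refine max_le (by simpa using hu0 x hx) ?_
        rw [EReal.coe_le_coe_iff]; norm_num
      rw [EReal.coe_le_coe_iff] at this
      linarith
    · rw [hout x hx]; norm_num
  have husc : UpperSemicontinuousOn (tr D u) D := by
    intro x hx y hy
    rw [tr_lt hu0 hx] at hy
    filter_upwards [hu.1 x hx _ hy.1, self_mem_nhdsWithin] with x' h1 h2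
    exact (tr_lt hu0 h2).2 ⟨h1, hy.2⟩
  have hmeas := meas_of_usc hDo hout hnn husc
  refine ⟨hmeas, hout, hnn, hle, husc, ?_⟩
  intro a b hab
  have ha : a ∈ D := by simpa using hab 0 (by simp)
  have h1 := (hu.2.2 a b).2 0 1 one_pos (by
    intro ζ hζ
    exact hab ζ (by simpa using hζ)) 1
  have h2 : truncCircleAvg (fun ζ => u (a + ζ • b)) 0 1 1
      = (2 * Real.pi)⁻¹ * (∫ φ in (0:ℝ)..(2 * Real.pi),
        tr D u (a + Complex.exp (φ * Complex.I) • b)) - 1 := by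
    have e : ∀ φ : ℝ, (max (u (a + ((0:ℂ) + ((1:ℝ) : ℂ) * Complex.exp (φ * Complex.I)) • b))
        ((-((1 : ℕ) : ℝ) : ℝ) : EReal)).toReal
        = tr D u (a + Complex.exp (φ * Complex.I) • b) - 1 := by
      intro φ
      have hin := hab (Complex.exp (φ * Complex.I)) (by rw [Complex.norm_exp_ofReal_mul_I])
      simp [tr, hin]
    unfold truncCircleAvg
    simp only [e]
    have hI : IntervalIntegrable (fun φ : ℝ => tr D u (a + Complex.exp (φ * Complex.I) • b)) volume
        0 (2 * Real.pi) :=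
      bdd_intble (hmeas.comp (circ_cont a b).measurable) (fun _ => hnn _) (fun _ => hle _) _ _
    rw [intervalIntegral.integral_sub hI intervalIntegrable_const, intervalIntegral.integral_const, mul_sub]
    have : (2 * Real.pi)⁻¹ * ((2 * Real.pi - 0) • (1:ℝ)) = 1 := by
      simp; field_simp
    rw [this]
  have h3 : u a ≤ ((truncCircleAvg (fun ζ => u (a + ζ • b)) 0 1 1 : ℝ) : EReal) := by
    simpa using h1
  rw [h2] at h3
  have h4 : 0 ≤ (2 * Real.pi)⁻¹ * (∫ φ in (0:ℝ)..(2 * Real.pi),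
        tr D u (a + Complex.exp (φ * Complex.I) • b)) :=
    mul_nonneg (by positivity) (intervalIntegral.integral_nonneg (by positivity) fun _ _ => hnn _)
  have h5 := tr_coe hu0 ha
  have h6 := max_le h3 (EReal.coe_le_coe_iff.2 (by linarith : (-1 : ℝ) ≤ (2 * Real.pi)⁻¹ *
    (∫ φ in (0:ℝ)..(2 * Real.pi), tr D u (a + Complex.exp (φ * Complex.I) • b)) - 1))
  rw [← h5, EReal.coe_le_coe_iff] at h6
  linarith

lemma ev_neg {n : ℕ} {ρ : EE n → ℝ} {ζ v : EE n} {d : EE n →L[ℝ] ℝ} (hd : HasFDerivAt ρ d ζ)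
    (h0 : ρ ζ = 0) (hv : d v < 0) : ∀ᶠ t : ℝ in 𝓝[>] 0, ρ (ζ + t • v) < 0 := by
  have h1 : HasDerivAt (fun t : ℝ => ρ (ζ + t • v)) (d v) 0 := by
    have hl : HasDerivAt (fun t : ℝ => ζ + t • v) v 0 := by
      simpa using ((hasDerivAt_id (0:ℝ)).smul_const v).const_add ζ
    have hd' : HasFDerivAt ρ d (ζ + (0:ℝ) • v) := by simpa using hd
    exact hd'.comp_hasDerivAt (0:ℝ) hl
  have h2 := (hasDerivAt_iff_tendsto_slope.1 h1).mono_left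
    (nhdsWithin_mono _ (fun t (ht : t ∈ Ioi (0:ℝ)) => ne_of_gt ht))
  filter_upwards [h2.eventually (gt_mem_nhds hv), self_mem_nhdsWithin] with t ht ht0
  have ht0 : 0 < t := ht0
  simp only [slope_def_field, zero_smul, add_zero, h0, sub_zero] at ht
  by_contra hcon
  exact absurd ht (not_lt.2 (div_nonneg (not_lt.1 hcon) ht0.le))

lemma ker_sub {n : ℕ} {ρ₁ ρ₂ : EE n → ℝ} {ζ : EE n} {d₁ d₂ : EE n →L[ℝ] ℝ}
    (hd1 : HasFDerivAt ρ₁ d₁ ζ) (hd2 : HasFDerivAt ρ₂ d₂ ζ) (h1 : ρ₁ ζ = 0) (h2 : ρ₂ ζ = 0)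
    (hne : d₁ ≠ 0) (himp : ∀ x, ρ₁ x < 0 → ρ₂ x < 0) (v : EE n) (hv : d₁ v = 0) : d₂ v = 0 := by
  have A : ∀ w, d₁ w < 0 → d₂ w ≤ 0 := by
    intro w hw
    by_contra hcon
    push Not at hcon
    have e1 := ev_neg hd1 h1 hw
    have e2 := ev_neg (v := w) hd2.neg (by simp [h2]) (by simpa using hcon)
    obtain ⟨t, ht1, ht2⟩ := (e1.and e2).exists
    have := himp _ ht1
    simp at ht2
    linarith
  obtain ⟨w, hw⟩ : ∃ w, d₁ w < 0 := by
    by_contra hcon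
    push Not at hcon
    apply hne
    ext w
    have a := hcon w
    have b := hcon (-w)
    simp at b
    simp; linarith
  have B : ∀ v, d₁ v = 0 → d₂ v ≤ 0 := by
    intro v hv
    have hlim : Tendsto (fun ε : ℝ => d₂ v + ε * d₂ w) (𝓝[>] 0) (𝓝 (d₂ v)) := by
      have : Continuous (fun ε : ℝ => d₂ v + ε * d₂ w) := by fun_prop
      have := this.tendsto 0
      simp at this
      exact this.mono_left nhdsWithin_le_nhds
    refine le_of_tendsto hlim ?_
    filter_upwards [self_mem_nhdsWithin] with ε hε
    have hε : 0 < ε := hε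
    have := A (v + ε • w) (by simp [hv]; exact mul_neg_of_pos_of_neg hε hw)
    simpa using this
  refine le_antisymm (B v hv) ?_
  have := B (-v) (by simp [hv])
  simpa using this

lemma isometry_rot {n : ℕ} (g : TT n) : Isometry (rot g : EE n → EE n) := by
  refine Isometry.of_dist_eq fun x y => ?_
  rw [EuclideanSpace.dist_eq, EuclideanSpace.dist_eq]
  congr 1
  refine Finset.sum_congr rfl fun j _ => ?_
  rw [dist_eq_norm, dist_eq_norm, rot_apply, rot_apply, ← mul_sub, norm_mul, Circle.norm_coe,
    one_mul]

lemma exists_normal {n : ℕ} {D : Set (EE n)} {ρ : EE n → ℝ} {ζ : EE n} (hDρ : D = {z | ρ z < 0})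
    (h0 : ρ ζ = 0) (hdiff : DifferentiableAt ℝ ρ ζ) (hne : fderiv ℝ ρ ζ ≠ 0) :
    ∃ p : ℕ → EE n, Tendsto p atTop (𝓝 ζ) ∧ ∀ k, p k ∈ inwardNormal D ρ ζ := by
  set d := fderiv ℝ ρ ζ with hd
  obtain ⟨x, hx, hmax⟩ := (isCompact_closedBall (0 : EE n) 1).exists_isMinOn ⟨0, by simp⟩
    (f := d) d.continuous.continuousOn
  have hmin : ∀ y : EE n, ‖y‖ ≤ 1 → d x ≤ d y := fun y hy => hmax (by simpa using hy)
  have hneg : d x < 0 := by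
    by_contra hcon
    push Not at hcon
    apply hne
    ext w
    by_cases hw : w = 0
    · simp [hw]
    have hw' : ‖w‖ ≠ 0 := by simpa using hw
    have a := hmin (‖w‖⁻¹ • w) (by rw [norm_smul]; simp [hw'])
    have b := hmin (-(‖w‖⁻¹ • w)) (by rw [norm_neg, norm_smul]; simp [hw'])
    simp only [map_neg, map_smul, smul_eq_mul] at a b
    have e : ‖w‖⁻¹ * d w = 0 := by linarith
    rcases mul_eq_zero.1 e with h | h
    · exact absurd h (inv_ne_zero hw')
    · simpa using h
  have hx1 : ‖x‖ = 1 := by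
    have hx' : ‖x‖ ≤ 1 := by simpa using hx
    have hx0 : x ≠ 0 := by rintro rfl; simp at hneg
    have hp : 0 < ‖x‖ := norm_pos_iff.2 hx0
    have a := hmin (‖x‖⁻¹ • x) (by rw [norm_smul]; simp [hp.ne'])
    simp only [map_smul, smul_eq_mul] at a
    refine le_antisymm hx' ?_
    by_contra hcon
    push Not at hcon
    have : 1 < ‖x‖⁻¹ := (one_lt_inv₀ hp).2 hcon
    nlinarith
  have hbound : ∀ y : EE n, d x * ‖y‖ ≤ d y := by
    intro y
    by_cases hy : y = 0
    · simp [hy]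
    have hp : 0 < ‖y‖ := norm_pos_iff.2 hy
    have a := hmin (‖y‖⁻¹ • y) (by rw [norm_smul]; simp [hp.ne'])
    simp only [map_smul, smul_eq_mul] at a
    have := mul_le_mul_of_nonneg_right a hp.le
    rwa [mul_comm, mul_assoc, mul_comm (d y), ← mul_assoc, inv_mul_cancel₀ hp.ne', one_mul,
      mul_comm] at this
  have hev := ev_neg hdiff.hasFDerivAt h0 hneg
  have hlim : Tendsto (fun t : ℝ => ζ + t • x) (𝓝[>] 0) (𝓝 ζ) := by
    have : Continuous (fun t : ℝ => ζ + t • x) := by fun_prop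
    have := this.tendsto 0
    simp at this
    exact this.mono_left nhdsWithin_le_nhds
  have hmem : ∀ᶠ t : ℝ in 𝓝[>] 0, ζ + t • x ∈ inwardNormal D ρ ζ := by
    filter_upwards [hev, self_mem_nhdsWithin] with t ht ht0
    have ht0 : 0 < t := ht0
    have hx0 : x ≠ 0 := by rintro rfl; simp at hneg
    refine ⟨by rw [hDρ]; exact ht, by simp [ht0.ne', hx0], ?_⟩
    have hζT : ζ ∈ tangentHyperplane ρ ζ := by simp [tangentHyperplane]
    refine le_antisymm (Metric.infDist_le_dist_of_mem hζT) ?_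
    have e : dist (ζ + t • x) ζ = t := by
      rw [dist_eq_norm, add_sub_cancel_left, norm_smul, hx1, Real.norm_eq_abs, abs_of_pos ht0,
        mul_one]
    rw [e]
    refine (Metric.le_infDist ⟨ζ, hζT⟩).2 fun w hw => ?_
    have hw : d (w - ζ) = 0 := hw
    have b := hbound (ζ + t • x - w)
    have : d (ζ + t • x - w) = t * d x := by
      have : ζ + t • x - w = t • x - (w - ζ) := by abel
      rw [this, map_sub, hw, map_smul, smul_eq_mul, sub_zero]
    rw [this] at b
    rw [dist_eq_norm]
    nlinarith
  obtain ⟨s, hs⟩ := (𝓝[>] (0:ℝ)).exists_seq_tendsto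
  obtain ⟨N, hN⟩ := Filter.eventually_atTop.1 (hs.eventually hmem)
  refine ⟨fun k => ζ + s (k + N) • x, ?_, fun k => hN _ (by omega)⟩
  exact (hlim.comp hs).comp (tendsto_add_atTop_nat N)

lemma psh_of {n : ℕ} {D : Set (EE n)} {F : EE n → ℝ} (hF : ContinuousOn F D)
    (hsub : ∀ a b : EE n, (∀ ζ : ℂ, ‖ζ‖ ≤ 1 → a + ζ • b ∈ D) →
    F a ≤ (2 * Real.pi)⁻¹ * ∫ φ in (0:ℝ)..(2 * Real.pi), F (a + Complex.exp (φ * Complex.I) • b)) :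
    PshOn (fun z => ((F z : ℝ) : EReal)) D := by
  have hc : ContinuousOn (fun z => ((F z : ℝ) : EReal)) D :=
    continuous_coe_real_ereal.comp_continuousOn hF
  refine ⟨hc.upperSemicontinuousOn, fun z _ => EReal.coe_ne_top _, fun a b => ⟨?_, ?_⟩⟩
  · have hl : Continuous (fun ζ : ℂ => a + ζ • b) := by fun_prop
    exact (hc.comp hl.continuousOn (fun ζ hζ => hζ)).upperSemicontinuousOn
  · intro c r hr hball m
    rw [EReal.coe_le_coe_iff]
    have hin : ∀ ζ : ℂ, ‖ζ‖ ≤ 1 → (a + c • b) + ζ • ((r : ℂ) • b) ∈ D := by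
      intro ζ hζ
      have h1 : c + ζ * r ∈ closedBall c r := by
        rw [mem_closedBall, dist_eq_norm, add_sub_cancel_left, norm_mul, Complex.norm_real,
          Real.norm_eq_abs, abs_of_pos hr]
        nlinarith
      have h2 : a + (c + ζ * r) • b ∈ D := hball h1
      rwa [add_smul, mul_smul, ← add_assoc] at h2
    refine (hsub _ _ hin).trans ?_
    unfold truncCircleAvg
    refine mul_le_mul_of_nonneg_left ?_ (by positivity)
    have e : ∀ φ : ℝ, a + (c + (r : ℂ) * Complex.exp (φ * Complex.I)) • b
        = (a + c • b) + Complex.exp (φ * Complex.I) • ((r : ℂ) • b) := by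
      intro φ
      rw [add_smul, mul_comm, mul_smul, ← add_assoc]
    have hcF : Continuous (fun φ : ℝ =>
        F ((a + c • b) + Complex.exp (φ * Complex.I) • ((r : ℂ) • b))) :=
      hF.comp_continuous (circ_cont _ _) fun φ => hin _ (by rw [Complex.norm_exp_ofReal_mul_I])
    have e2 : ∀ x : ℝ, (max ((x : ℝ) : EReal) ((-(m : ℝ) : ℝ) : EReal)).toReal
        = max x (-(m : ℝ)) := by
      intro x
      rcases le_total x (-(m:ℝ)) with h | h
      · rw [max_eq_right h, max_eq_right (EReal.coe_le_coe_iff.2 h), EReal.toReal_coe]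
      · rw [max_eq_left h, max_eq_left (EReal.coe_le_coe_iff.2 h), EReal.toReal_coe]
    simp only [e, e2]
    refine intervalIntegral.integral_mono_on (by positivity) (hcF.intervalIntegrable _ _)
      ((hcF.max continuous_const).intervalIntegrable _ _) fun φ _ => le_max_left _ _

section Main

variable {n : ℕ} {D K : Set (EE n)} {ρ : EE n → ℝ}

lemma tang_rot (hρ : Differentiable ℝ ρ) (hDρ : D = {z | ρ z < 0})
    (hgrad : ∀ z ∈ D ∪ K, ρ z = 0 → fderiv ℝ ρ z ≠ 0) (hKz : ∀ z ∈ K, ρ z = 0)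
    (hD : Compl D) (hKc : ∀ z ∈ K, ∀ g : TT n, rot g z ∈ K) {ζ : EE n} (hζ : ζ ∈ K) (g : TT n)
    {w : EE n} (hw : w ∈ tangentHyperplane ρ ζ) :
    rot g w ∈ tangentHyperplane ρ (rot g ζ) := by
  have hL : HasFDerivAt (rot g : EE n → EE n)
      ((rotL g).toContinuousLinearEquiv : EE n →L[ℝ] EE n) ζ :=
    ((rotL g).toContinuousLinearEquiv : EE n →L[ℝ] EE n).hasFDerivAt
  have h2 : HasFDerivAt (fun x => ρ (rot g x)) ((fderiv ℝ ρ (rot g ζ)).comp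
      ((rotL g).toContinuousLinearEquiv : EE n →L[ℝ] EE n)) ζ :=
    (hρ (rot g ζ)).hasFDerivAt.comp ζ hL
  have := ker_sub (hρ ζ).hasFDerivAt h2 (hKz ζ hζ) (hKz _ (hKc ζ hζ g))
    (hgrad ζ (Or.inr hζ) (hKz ζ hζ)) (fun x hx => by
      have hx : x ∈ D := by rw [hDρ]; exact hx
      have := hD.rot g hx
      rw [hDρ] at this
      exact this) (w - ζ) hw
  have e : rot g w - rot g ζ = rot g (w - ζ) := ((rotL g).map_sub w ζ).symm
  change fderiv ℝ ρ (rot g ζ) (rot g w - rot g ζ) = 0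
  rw [e]
  exact this

lemma normal_rot (hρ : Differentiable ℝ ρ) (hDρ : D = {z | ρ z < 0})
    (hgrad : ∀ z ∈ D ∪ K, ρ z = 0 → fderiv ℝ ρ z ≠ 0) (hKz : ∀ z ∈ K, ρ z = 0)
    (hD : Compl D) (hKc : ∀ z ∈ K, ∀ g : TT n, rot g z ∈ K) {ζ : EE n} (hζ : ζ ∈ K) (g : TT n)
    {p : EE n} (hp : p ∈ inwardNormal D ρ ζ) : rot g p ∈ inwardNormal D ρ (rot g ζ) := by
  obtain ⟨h1, h2, h3⟩ := hp
  have hT : tangentHyperplane ρ (rot g ζ) = rot g '' tangentHyperplane ρ ζ := by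
    ext w
    constructor
    · intro hw
      have := tang_rot hρ hDρ hgrad hKz hD hKc (hKc ζ hζ g) g⁻¹ hw
      rw [← rot_mul, inv_mul_cancel, rot_one] at this
      exact ⟨_, this, by rw [← rot_mul, mul_inv_cancel, rot_one]⟩
    · rintro ⟨w, hw, rfl⟩
      exact tang_rot hρ hDρ hgrad hKz hD hKc hζ g hw
  refine ⟨hD.rot g h1, fun h => h2 ((isometry_rot g).injective h), ?_⟩
  rw [hT, Metric.infDist_image (isometry_rot g), (isometry_rot g).dist_eq, h3]

lemma zero_inside (hDo : IsOpen D) (hρ : Differentiable ℝ ρ) (hDρ : D = {z | ρ z < 0})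
    (hgrad : ∀ z ∈ D ∪ K, ρ z = 0 → fderiv ℝ ρ z ≠ 0) (hKz : ∀ z ∈ K, ρ z = 0)
    (hD : Compl D) (hKc : ∀ z ∈ K, ∀ g : TT n, rot g z ∈ K)
    {u : EE n → EReal} (hu : PshOn u D) (hu0 : ∀ y ∈ D, u y ≤ 0)
    (hlim : ∀ ζ ∈ K, Filter.limsup u (𝓝[inwardNormal D ρ ζ] ζ) ≤ -1)
    {ζ : EE n} (hζ : ζ ∈ K) {z : EE n} (hz : ∀ j, ‖z j‖ < ‖ζ j‖) : tr D u z = 0 := by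
  have hV := tr_good hDo hu hu0
  have hA := hV.avg hD hDo
  obtain ⟨p, hp, hpn⟩ := exists_normal hDρ (hKz ζ hζ) (hρ ζ) (hgrad ζ (Or.inr hζ) (hKz ζ hζ))
  have hpD : ∀ k, p k ∈ D := fun k => (hpn k).1
  -- pointwise limits
  have hpt : ∀ g : TT n, Tendsto (fun k => tr D u (rot g (p k))) atTop (𝓝 0) := by
    intro g
    rw [tendsto_order]
    refine ⟨fun c hc => Filter.Eventually.of_forall fun k => hc.trans_le (hV.nn _), fun c hc => ?_⟩
    have h1 : Filter.limsup u (𝓝[inwardNormal D ρ (rot g ζ)] (rot g ζ)) < ((c - 1 : ℝ) : EReal) := by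
      refine (hlim _ (hKc ζ hζ g)).trans_lt ?_
      have : (-1 : EReal) = ((-1 : ℝ) : EReal) := by simp
      rw [this, EReal.coe_lt_coe_iff]
      linarith
    have h2 := Filter.eventually_lt_of_limsup_lt h1
    have h3 : Tendsto (fun k => rot g (p k)) atTop (𝓝[inwardNormal D ρ (rot g ζ)] (rot g ζ)) := by
      refine tendsto_nhdsWithin_iff.2 ⟨((continuous_rot_right g).tendsto ζ).comp hp, ?_⟩
      exact Filter.Eventually.of_forall fun k =>
        normal_rot hρ hDρ hgrad hKz hD hKc hζ g (hpn k)
    filter_upwards [h3.eventually h2] with k hk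
    exact (tr_lt hu0 (hD.rot g (hpD k))).2 ⟨hk, hc⟩
  have havg : Tendsto (fun k => RH.avg (tr D u) (p k)) atTop (𝓝 0) := by
    have := tendsto_integral_of_dominated_convergence (μ := haarT n)
      (F := fun k g => tr D u (rot g (p k))) (f := fun _ => 0) (fun _ => (1 : ℝ))
      (fun k => (hV.meas_rot _).aestronglyMeasurable) (integrable_const _)
      (fun k => Filter.Eventually.of_forall fun g => by
        rw [Real.norm_eq_abs, abs_of_nonneg (hV.nn _)]; exact hV.le _)
      (Filter.Eventually.of_forall hpt)
    simpa [RH.avg] using this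
  set P : Set (EE n) := {x | ∀ j, ‖x j‖ < ‖ζ j‖} with hP
  have hPo : IsOpen P := by
    have : P = ⋂ j, {x : EE n | ‖x j‖ < ‖ζ j‖} := by
      ext x; simp [hP]
    rw [this]
    exact isOpen_iInter_of_finite fun j => isOpen_lt (by fun_prop) continuous_const
  have hev : ∀ x ∈ P, ∀ᶠ k in atTop, ∀ j, ‖x j‖ ≤ ‖p k j‖ := by
    intro x hx
    rw [Filter.eventually_all]
    intro j
    have hcn : Continuous (fun x : EE n => ‖x j‖) := by fun_prop
    filter_upwards [((hcn.tendsto ζ).comp hp).eventually (lt_mem_nhds (hx j))] with k hk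
    exact le_of_lt hk
  have hPD : P ⊆ D := by
    intro x hx
    obtain ⟨k, hk⟩ := (hev x hx).exists
    exact hD _ (hpD k) x hk
  refine hV.zero hPo hPD (fun x hx w hw j => (hw j).trans_lt (hx j)) ?_ (z := z) hz
  intro x hx
  refine le_antisymm (ge_of_tendsto havg ?_) (hA.nn x)
  filter_upwards [hev x hx] with k hk
  exact hA.mono (circ_avg _) hD (hpD k) hk

lemma smul_closure (hD : Compl D) {r : ℝ} (hr0 : 0 < r) (hr1 : r < 1) {x : EE n}
    (hx : x ∈ closure D) : (r : ℂ) • x ∈ D := by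
  have hev : ∀ j, ∀ᶠ y in 𝓝 x, ‖((r : ℂ) • x) j‖ ≤ ‖y j‖ := by
    intro j
    have e : ‖((r : ℂ) • x) j‖ = r * ‖x j‖ := by simp [abs_of_pos hr0]
    rw [e]
    by_cases hj : x j = 0
    · simp [hj]
    · have hlt : r * ‖x j‖ < ‖x j‖ := mul_lt_of_lt_one_left (norm_pos_iff.2 hj) hr1
      have hcn : Continuous (fun x : EE n => ‖x j‖) := by fun_prop
      filter_upwards [(hcn.tendsto x).eventually (lt_mem_nhds hlt)] with y hy using hy.le
  obtain ⟨y, hy, hyD⟩ := ((mem_closure_iff_frequently.1 hx).and_eventually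
    (Filter.eventually_all.2 hev)).exists
  exact hD y hy _ hyD

lemma hard (hDo : IsOpen D) (hρ : Differentiable ℝ ρ) (hDρ : D = {z | ρ z < 0})
    (hgrad : ∀ z ∈ D ∪ K, ρ z = 0 → fderiv ℝ ρ z ≠ 0) (hKz : ∀ z ∈ K, ρ z = 0)
    (hD : Compl D) (hKc : ∀ z ∈ K, ∀ g : TT n, rot g z ∈ K) (hKne : ∀ z ∈ K, ∀ j, z j ≠ 0)
    {z : EE n} (hz : z ∈ D) : bndExtNormal D ρ z K ≤ bndExtCont z K D := by
  refine sSup_le ?_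
  rintro _ ⟨u, ⟨hu, -⟩, hu0, hlim, rfl⟩
  have hV := tr_good hDo hu hu0
  have hW := hV.sup hD hDo
  have hWc : Circ (fun x => ⨆ g : TT n, tr D u (rot g x)) := circ_sup _
  have hVW : ∀ x, tr D u x ≤ ⨆ g : TT n, tr D u (rot g x) := by
    intro x
    have := le_ciSup (hV.bddAbove x) 1
    simpa only [rot_one] using this
  have hWK : ∀ x ∈ K, ∀ r : ℝ, 0 < r → r < 1 → (⨆ g : TT n, tr D u (rot g ((r : ℂ) • x))) ≤ 0 := by
    intro x hx r hr0 hr1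
    refine ciSup_le fun g => le_of_eq ?_
    refine zero_inside hDo hρ hDρ hgrad hKz hD hKc hu hu0 hlim hx fun j => ?_
    rw [rot_norm_apply]
    simp only [PiLp.smul_apply, smul_eq_mul, norm_mul, Complex.norm_real, Real.norm_eq_abs,
      abs_of_pos hr0]
    exact mul_lt_of_lt_one_left (norm_pos_iff.2 (hKne x hx j)) hr1
  set W : EE n → ℝ := fun x => ⨆ g : TT n, tr D u (rot g x) with hWdef
  have hcont := hW.cont hWc hD hDo
  have hcomp : ∀ r : ℝ, 0 < r → r < 1 →
      ((W ((r : ℂ) • z) - 1 : ℝ) : EReal) ≤ bndExtCont z K D := by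
    intro r hr0 hr1
    refine le_sSup ⟨fun x => W ((r : ℂ) • x) - 1, ?_, ?_, ?_, ?_, rfl⟩
    · have hs : Continuous (fun x : EE n => (r : ℂ) • x) := by fun_prop
      exact (hcont.comp hs.continuousOn fun x hx => smul_closure hD hr0 hr1 hx).sub
        continuousOn_const
    · refine psh_of ?_ ?_
      · have hs : Continuous (fun x : EE n => (r : ℂ) • x) := by fun_prop
        exact (hcont.comp hs.continuousOn fun x hx =>
          smul_closure hD hr0 hr1 (subset_closure hx)).sub continuousOn_const
      · intro a b hab
        have h1 := hW.sub ((r : ℂ) • a) ((r : ℂ) • b) (fun ζ hζ => by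
          have := smul_closure hD hr0 hr1 (subset_closure (hab ζ hζ))
          rwa [smul_add, smul_comm] at this)
        have e : ∀ φ : ℝ, W ((r : ℂ) • (a + Complex.exp (φ * Complex.I) • b))
            = W ((r : ℂ) • a + Complex.exp (φ * Complex.I) • ((r : ℂ) • b)) := by
          intro φ; rw [smul_add, smul_comm]
        simp only [e]
        rw [intervalIntegral.integral_sub (hW.intble _ _ _ _) intervalIntegrable_const,
          intervalIntegral.integral_const, mul_sub]
        have : (2 * Real.pi)⁻¹ * ((2 * Real.pi - 0) • (1:ℝ)) = 1 := by
          simp; field_simp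
        rw [this]
        exact sub_le_sub_right h1 1
    · intro y _
      have := hW.le ((r : ℂ) • y)
      simp only [hWdef] at this ⊢
      linarith
    · intro x hx
      have := hWK x hx r hr0 hr1
      linarith
  have h1 : u z ≤ ((W z - 1 : ℝ) : EReal) := by
    calc u z ≤ max (u z) ((-1 : ℝ) : EReal) := le_max_left _ _
      _ = ((tr D u z - 1 : ℝ) : EReal) := (tr_coe hu0 hz).symm
      _ ≤ _ := EReal.coe_le_coe_iff.2 (sub_le_sub_right (hVW z) 1)
  refine h1.trans ?_
  have hlim2 : Tendsto (fun ε : ℝ => ((W z - 1 - ε : ℝ) : EReal)) (𝓝[>] 0)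
      (𝓝 ((W z - 1 : ℝ) : EReal)) := by
    have : Continuous (fun ε : ℝ => ((W z - 1 - ε : ℝ) : EReal)) :=
      continuous_coe_real_ereal.comp (by fun_prop)
    have := this.tendsto 0
    rw [sub_zero] at this
    exact this.mono_left nhdsWithin_le_nhds
  refine le_of_tendsto hlim2 ?_
  filter_upwards [self_mem_nhdsWithin] with ε hε
  obtain ⟨r, hr0, hr1, hr⟩ := hW.left hWc hD hDo hz hε
  refine le_trans (EReal.coe_le_coe_iff.2 ?_) (hcomp r hr0 hr1)
  linarith

lemma cont_le (hne : D.Nonempty) (hKb : K ⊆ closure D) (z : EE n) :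
    bndExtCont z K D ≤ bndExt z K D := by
  refine sSup_le ?_
  rintro _ ⟨F, hF, hpsh, hF0, hFK, rfl⟩
  refine le_sSup ⟨fun y => ((F y : ℝ) : EReal), ⟨hpsh, ?_⟩, ?_, ?_, rfl⟩
  · obtain ⟨y, hy⟩ := hne
    exact ⟨y, hy, EReal.coe_ne_bot _⟩
  · intro y hy
    exact EReal.coe_nonpos.2 (hF0 y (subset_closure hy))
  · intro x hx
    have h1 : Tendsto (fun y => ((F y : ℝ) : EReal)) (𝓝[D] x) (𝓝 ((F x : ℝ) : EReal)) :=
      (continuous_coe_real_ereal.tendsto _).comp ((hF x (hKb hx)).mono subset_closure)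
    have : (𝓝[D] x).NeBot := mem_closure_iff_nhdsWithin_neBot.1 (hKb hx)
    unfold uscReg
    rw [h1.limsup_eq]
    exact (EReal.coe_le_coe_iff.2 (hFK x hx)).trans (le_of_eq (by simp))

lemma ext_le (z : EE n) : bndExt z K D ≤ bndExtSharp D ρ z K := by
  refine sSup_le ?_
  rintro _ ⟨u, hu, hu0, hK, rfl⟩
  refine le_sSup ⟨u, hu, hu0, fun ξ hξ => ?_, rfl⟩
  refine iSup₂_le fun α _ => ?_
  refine le_trans (limsup_le_limsup_of_le (nhdsWithin_mono _ fun y hy => hy.1)) (hK ξ hξ)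

lemma sharp_le (z : EE n) : bndExtSharp D ρ z K ≤ bndExtNormal D ρ z K := by
  refine sSup_le ?_
  rintro _ ⟨u, hu, hu0, hK, rfl⟩
  refine le_sSup ⟨u, hu, hu0, fun ξ hξ => ?_, rfl⟩
  refine le_trans ?_ (hK ξ hξ)
  refine le_trans ?_ (le_iSup₂ (2 : ℝ) (by norm_num))
  refine limsup_le_limsup_of_le (nhdsWithin_mono _ ?_)
  rintro y ⟨h1, h2, h3⟩
  refine ⟨h1, ?_⟩
  rw [h3]
  have := dist_pos.2 h2
  linarith

end Main

theorem main {n : ℕ}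
    (D K : Set (EuclideanSpace ℂ (Fin n))) (hD : IsBddDomain D)
    (ρ : EuclideanSpace ℂ (Fin n) → ℝ) (hρ : ContDiff ℝ (⊤ : ℕ∞) ρ)
    (hDρ : D = {z | ρ z < 0}) (hfr : frontier D = {z | ρ z = 0})
    (hgrad : ∀ z ∈ frontier D, fderiv ℝ ρ z ≠ 0)
    (hcomplete : ∀ z ∈ D, ∀ w : EuclideanSpace ℂ (Fin n),
      (∀ j, ‖w j‖ ≤ ‖z j‖) → w ∈ D)
    (_hK : IsCompact K) (hKb : K ⊆ frontier D)
    (hKcirc : ∀ z ∈ K, ∀ θ : Fin n → ℝ, ∀ w : EuclideanSpace ℂ (Fin n),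
      (∀ j, w j = Complex.exp ((θ j : ℂ) * Complex.I) * z j) → w ∈ K)
    (hKne : ∀ z ∈ K, ∀ j, z j ≠ 0) :
    (∀ z ∈ D,
      bndExtCont z K D = bndExt z K D ∧
      bndExt z K D = bndExtSharp D ρ z K ∧
      bndExtSharp D ρ z K = bndExtNormal D ρ z K) ∧
    (∀ x ∈ closure D,
      Filter.limsup (fun z => bndExtCont z K D) (𝓝[D] x) =
        Filter.limsup (fun z => bndExt z K D) (𝓝[D] x) ∧
      Filter.limsup (fun z => bndExt z K D) (𝓝[D] x) =
        Filter.limsup (fun z => bndExtSharp D ρ z K) (𝓝[D] x) ∧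
      Filter.limsup (fun z => bndExtSharp D ρ z K) (𝓝[D] x) =
        Filter.limsup (fun z => bndExtNormal D ρ z K) (𝓝[D] x)) := by
  have hKz : ∀ z ∈ K, ρ z = 0 := fun z hz => by
    have := hKb hz
    rw [hfr] at this
    exact this
  have hKc : ∀ z ∈ K, ∀ g : TT n, rot g z ∈ K := by
    intro z hz g
    refine hKcirc z hz (fun j => Complex.arg (g j)) _ fun j => ?_
    rw [rot_apply]
    congr 1
    have := Complex.norm_mul_exp_arg_mul_I (g j : ℂ)
    rw [Circle.norm_coe] at this
    simpa using this.symm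
  have h1 : ∀ z, bndExtCont z K D ≤ bndExt z K D :=
    cont_le hD.2.1.nonempty (hKb.trans frontier_subset_closure)
  have h2 : ∀ z, bndExt z K D ≤ bndExtSharp D ρ z K := ext_le
  have h3 : ∀ z, bndExtSharp D ρ z K ≤ bndExtNormal D ρ z K := sharp_le
  have h4 : ∀ z ∈ D, bndExtNormal D ρ z K ≤ bndExtCont z K D := fun z hz =>
    hard hD.1 (hρ.differentiable (by simp)) hDρ
      (fun z _ h => hgrad z (by rw [hfr]; exact h)) hKz hcomplete hKc hKne hz
  have key : ∀ z ∈ D,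
      bndExtCont z K D = bndExt z K D ∧
      bndExt z K D = bndExtSharp D ρ z K ∧
      bndExtSharp D ρ z K = bndExtNormal D ρ z K := fun z hz =>
    ⟨le_antisymm (h1 z) ((h2 z).trans ((h3 z).trans (h4 z hz))),
      le_antisymm (h2 z) ((h3 z).trans ((h4 z hz).trans (h1 z))),
      le_antisymm (h3 z) ((h4 z hz).trans ((h1 z).trans (h2 z)))⟩
  refine ⟨key, fun x _ => ⟨?_, ?_, ?_⟩⟩
  · exact limsup_congr (by filter_upwards [self_mem_nhdsWithin] with z hz using (key z hz).1)
  · exact limsup_congr (by filter_upwards [self_mem_nhdsWithin] with z hz using (key z hz).2.1)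
  · exact limsup_congr (by filter_upwards [self_mem_nhdsWithin] with z hz using (key z hz).2.2)

end RH

/-- For a smoothly bounded complete pseudoconvex Reinhardt domain
`D ⊆ ℂⁿ` (with smooth defining function `ρ`) and a multi-circular compact `K ⊆ ∂D`
avoiding the coordinate hyperplanes, all four boundary extremal functions
`ω₁, ω, ω̃, ω₃` coincide on `D`; in particular their upper semicontinuous
regularizations coincide on `cl(D)`. -/
theorem bndExt_all_eq_of_Reinhardt {n : ℕ}
    (D K : Set (EuclideanSpace ℂ (Fin n))) (hD : IsBddDomain D)
    -- `D` is smoothly bounded, with global smooth defining function `ρ`: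
    (ρ : EuclideanSpace ℂ (Fin n) → ℝ) (hρ : ContDiff ℝ (⊤ : ℕ∞) ρ)
    (hDρ : D = {z | ρ z < 0}) (hfr : frontier D = {z | ρ z = 0})
    (hgrad : ∀ z ∈ frontier D, fderiv ℝ ρ z ≠ 0)
    -- `D` is a complete Reinhardt domain:
    (hcomplete : ∀ z ∈ D, ∀ w : EuclideanSpace ℂ (Fin n),
      (∀ j, ‖w j‖ ≤ ‖z j‖) → w ∈ D)
    -- `D` is pseudoconvex: `-log dist(·, ∂D)` is plurisubharmonic on `D`:
    (hpsc : PshOn (fun z => ((- Real.log (Metric.infDist z Dᶜ) : ℝ) : EReal)) D)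
    -- `K` is a multi-circular compact subset of `∂D` avoiding the coordinate hyperplanes:
    (hK : IsCompact K) (hKb : K ⊆ frontier D)
    (hKcirc : ∀ z ∈ K, ∀ θ : Fin n → ℝ, ∀ w : EuclideanSpace ℂ (Fin n),
      (∀ j, w j = Complex.exp ((θ j : ℂ) * Complex.I) * z j) → w ∈ K)
    (hKne : ∀ z ∈ K, ∀ j, z j ≠ 0) :
    (∀ z ∈ D,
      bndExtCont z K D = bndExt z K D ∧
      bndExt z K D = bndExtSharp D ρ z K ∧
      bndExtSharp D ρ z K = bndExtNormal D ρ z K) ∧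
    (∀ x ∈ closure D,
      Filter.limsup (fun z => bndExtCont z K D) (𝓝[D] x) =
        Filter.limsup (fun z => bndExt z K D) (𝓝[D] x) ∧
      Filter.limsup (fun z => bndExt z K D) (𝓝[D] x) =
        Filter.limsup (fun z => bndExtSharp D ρ z K) (𝓝[D] x) ∧
      Filter.limsup (fun z => bndExtSharp D ρ z K) (𝓝[D] x) =
        Filter.limsup (fun z => bndExtNormal D ρ z K) (𝓝[D] x)) := by
  exact RH.main D K hD ρ hρ hDρ hfr hgrad hcomplete hK hKb hKcirc hKne
end

section
/- Let D ⊆ ℂⁿ be a bounded domain and A ⊆ ∂D. Then the following are equivalent: (1) ω*(x, A, D) = 0 for every x ∈ cl(D); (2) A is b-pluripolar. -/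
open Complex Metric MeasureTheory Filter Topology Set

section Aux

lemma trunc_pt (f : ENNReal) (m : ℕ) :
    (max (-(f : EReal)) ((-(m : ℝ) : ℝ) : EReal)).toReal = -(min f (m : ENNReal)).toReal := by
  have h : max (-(f : EReal)) ((-(m : ℝ) : ℝ) : EReal) = -((min f (m : ENNReal) : ENNReal) : EReal) := by
    have e : ((-(m : ℝ) : ℝ) : EReal) = -(((m : ENNReal)) : EReal) := by
      rw [EReal.coe_neg]
      congr 1
    rw [e]
    rcases le_total f (m : ENNReal) with h | h
    · rw [min_eq_left h, max_eq_left]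
      exact EReal.neg_le_neg_iff.2 (EReal.coe_ennreal_le_coe_ennreal_iff.2 h)
    · rw [min_eq_right h, max_eq_right]
      exact EReal.neg_le_neg_iff.2 (EReal.coe_ennreal_le_coe_ennreal_iff.2 h)
  rw [h, EReal.toReal_neg_eq, EReal.toReal_coe_ennreal]

lemma neg_le_coe_neg_iff (g : ENNReal) (s : ℝ) (hs : 0 ≤ s) :
    -(g : EReal) ≤ ((-s : ℝ) : EReal) ↔ ENNReal.ofReal s ≤ g := by
  rw [EReal.coe_neg, EReal.neg_le_neg_iff, ← EReal.coe_ennreal_le_coe_ennreal_iff,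
    EReal.coe_ennreal_ofReal, max_eq_left hs]

lemma avg_core (F : ℝ → ENNReal) (hF : Measurable F) (g : ENNReal) :
    (∀ m : ℕ, -(g : EReal) ≤ (((2 * Real.pi)⁻¹ * ∫ θ in (0:ℝ)..(2 * Real.pi),
      (max (-(F θ : EReal)) ((-(m : ℝ) : ℝ) : EReal)).toReal : ℝ) : EReal)) ↔
    ∫⁻ θ in Ioc 0 (2 * Real.pi), F θ ≤ ENNReal.ofReal (2 * Real.pi) * g := by
  have hpi : 0 < 2 * Real.pi := by positivity
  have key : ∀ m : ℕ, (-(g : EReal) ≤ (((2 * Real.pi)⁻¹ * ∫ θ in (0:ℝ)..(2 * Real.pi),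
      (max (-(F θ : EReal)) ((-(m : ℝ) : ℝ) : EReal)).toReal : ℝ) : EReal)) ↔
      ∫⁻ θ in Ioc 0 (2 * Real.pi), min (F θ) m ≤ ENNReal.ofReal (2 * Real.pi) * g := by
    intro m
    have hm : Measurable fun θ => min (F θ) (m : ENNReal) := hF.min measurable_const
    have hfin : ∫⁻ θ in Ioc 0 (2 * Real.pi), min (F θ) m ≠ ⊤ := by
      have : ∫⁻ θ in Ioc 0 (2 * Real.pi), min (F θ) m ≤
          ∫⁻ θ in Ioc 0 (2 * Real.pi), (m : ENNReal) := lintegral_mono fun _ => min_le_right _ _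
      refine ne_top_of_le_ne_top ?_ this
      simp [ENNReal.mul_eq_top]
    simp only [trunc_pt]
    rw [intervalIntegral.integral_neg, intervalIntegral.integral_of_le hpi.le,
      integral_toReal hm.aemeasurable
        (Eventually.of_forall fun θ => lt_of_le_of_lt (min_le_right _ _) (ENNReal.natCast_lt_top m)),
      mul_neg, neg_le_coe_neg_iff _ _ (by positivity),
      ENNReal.ofReal_mul (by positivity), ENNReal.ofReal_toReal hfin, ENNReal.ofReal_inv_of_pos hpi]
    exact ENNReal.inv_mul_le_iff (by simpa using Real.pi_pos) ENNReal.ofReal_ne_top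
  simp only [key]
  constructor
  · intro h
    have e : ∀ θ, F θ = ⨆ m : ℕ, min (F θ) (m : ENNReal) := by
      intro θ
      have h2 : (⨆ m : ℕ, (m : ENNReal)) = ⊤ := ENNReal.iSup_natCast
      rw [← inf_iSup_eq, h2, inf_top_eq]
    rw [lintegral_congr e, lintegral_iSup (fun m => hF.min measurable_const)]
    · exact iSup_le h
    · intro a b hab θ
      exact min_le_min le_rfl (by exact_mod_cast hab)
  · intro h m
    exact (lintegral_mono fun _ => min_le_left _ _).trans h

variable {E : Type*} [NormedAddCommGroup E] [NormedSpace ℂ E]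

/-- Nonnegative plurisuperharmonic functions with values in `[0,∞]`. -/
def SupH (f : E → ENNReal) (D : Set E) : Prop :=
  LowerSemicontinuousOn f D ∧ ∀ a b : E, (∀ ζ : ℂ, ‖ζ‖ ≤ 1 → a + ζ • b ∈ D) →
    ∫⁻ θ in Ioc (0:ℝ) (2 * Real.pi), f (a + Complex.exp (θ * Complex.I) • b)
      ≤ ENNReal.ofReal (2 * Real.pi) * f a

lemma meas_circle {f : E → ENNReal} {D : Set E} (hf : LowerSemicontinuousOn f D) {a b : E}
    (h : ∀ ζ : ℂ, ‖ζ‖ ≤ 1 → a + ζ • b ∈ D) :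
    Measurable fun θ : ℝ => f (a + Complex.exp (θ * Complex.I) • b) := by
  apply LowerSemicontinuous.measurable
  rw [← lowerSemicontinuousOn_univ_iff]
  refine hf.comp (g := fun θ : ℝ => a + Complex.exp (θ * Complex.I) • b) ?_ ?_
  · exact Continuous.continuousOn (by fun_prop)
  · intro θ _
    exact h _ (by rw [Complex.norm_exp_ofReal_mul_I])

lemma pshOn_iff {u : E → EReal} {f : E → ENNReal} {D : Set E}
    (hu : ∀ z ∈ D, u z = -(f z : EReal)) : PshOn u D ↔ SupH f D := by
  have circ : ∀ {a b : E}, (∀ ζ : ℂ, ‖ζ‖ ≤ 1 → a + ζ • b ∈ D) → ∀ θ : ℝ,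
      u (a + Complex.exp (θ * Complex.I) • b) =
        -(f (a + Complex.exp (θ * Complex.I) • b) : EReal) := fun h θ =>
    hu _ (h _ (by rw [Complex.norm_exp_ofReal_mul_I]))
  constructor
  · rintro ⟨h1, -, h3⟩
    have hl : LowerSemicontinuousOn f D := by
      have := (EReal.continuous_toENNReal.comp continuous_neg).comp_upperSemicontinuousOn_antitone h1
        (fun x y hxy => EReal.toENNReal_le_toENNReal (EReal.neg_le_neg_iff.2 hxy))
      intro x hx y hy
      have h := this x hx y (by simpa [hu x hx] using hy)
      filter_upwards [h, self_mem_nhdsWithin] with z hz hzD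
      simpa [hu z hzD] using hz
    refine ⟨hl, fun a b hab => ?_⟩
    rw [← avg_core _ (meas_circle hl hab)]
    intro m
    have := (h3 a b).2 0 1 one_pos (fun ζ hζ => hab ζ (by simpa using hζ)) m
    simp only [truncCircleAvg] at this
    simp only [zero_add, ofReal_one, one_mul, zero_smul, add_zero, circ hab] at this
    rwa [hu a (by simpa using hab 0 (by simp))] at this
  · rintro ⟨hl, h2⟩
    have husc : UpperSemicontinuousOn u D := by
      have := (continuous_neg.comp continuous_coe_ennreal_ereal).comp_lowerSemicontinuousOn_antitone hl
        (fun x y hxy => EReal.neg_le_neg_iff.2 (EReal.coe_ennreal_le_coe_ennreal_iff.2 hxy))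
      intro x hx y hy
      have h := this x hx y (by simpa [hu x hx] using hy)
      filter_upwards [h, self_mem_nhdsWithin] with z hz hzD
      simpa [hu z hzD] using hz
    refine ⟨husc, fun z hz => ?_, fun a b => ⟨?_, fun c r hr hcr m => ?_⟩⟩
    · rw [hu z hz]
      simp [EReal.neg_eq_top_iff]
    · exact husc.comp (g := fun ζ : ℂ => a + ζ • b) (Continuous.continuousOn (by fun_prop))
        (fun ζ hζ => hζ)
    · have hab : ∀ ζ : ℂ, ‖ζ‖ ≤ 1 → (a + c • b) + ζ • ((r : ℂ) • b) ∈ D := by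
        intro ζ hζ
        have : c + ζ * r ∈ {ζ : ℂ | a + ζ • b ∈ D} := by
          apply hcr
          simp only [mem_closedBall, dist_self_add_left, norm_mul, norm_real, Real.norm_eq_abs,
            abs_of_pos hr]
          nlinarith
        simpa [add_smul, mul_smul, add_assoc] using this
      have := (avg_core _ (meas_circle hl hab) _).2 (h2 _ _ hab) m
      have hc : a + c • b ∈ D := by simpa using hab 0 (by simp)
      simp only [truncCircleAvg]
      have e : ∀ θ : ℝ, a + (c + (r : ℂ) * Complex.exp (θ * Complex.I)) • b =
          (a + c • b) + Complex.exp (θ * Complex.I) • ((r : ℂ) • b) := by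
        intro θ
        rw [add_smul, mul_comm, mul_smul, add_assoc]
      simp only [e, circ hab]
      rwa [hu _ hc]

lemma SupH.tsum {f : ℕ → E → ENNReal} {D : Set E} (hf : ∀ i, SupH (f i) D) :
    SupH (fun z => ∑' i, f i z) D := by
  refine ⟨lowerSemicontinuousOn_tsum fun i => (hf i).1, fun a b hab => ?_⟩
  rw [lintegral_tsum fun i => (meas_circle (hf i).1 hab).aemeasurable, ← ENNReal.tsum_mul_left]
  exact ENNReal.tsum_le_tsum fun i => (hf i).2 a b hab

lemma SupH.const_mul {f : E → ENNReal} {D : Set E} (hf : SupH f D) {c : ENNReal} (hc : c ≠ ⊤) :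
    SupH (fun z => c * f z) D := by
  refine ⟨?_, fun a b hab => ?_⟩
  · exact (ENNReal.continuous_const_mul hc).comp_lowerSemicontinuousOn hf.1
      (fun x y h => mul_le_mul_right h c)
  · rw [lintegral_const_mul _ (meas_circle hf.1 hab), mul_left_comm]
    exact mul_le_mul_right (hf.2 a b hab) c

lemma lsc_indicator {f : E → ENNReal} {D : Set E} (hD : IsOpen D)
    (hf : LowerSemicontinuousOn f D) : LowerSemicontinuous (D.indicator f) := by
  intro x y hy
  by_cases hx : x ∈ D
  · have h := hf x hx y (by simpa [hx] using hy)
    rw [hD.nhdsWithin_eq hx] at h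
    filter_upwards [h, hD.mem_nhds hx] with z hz hzD
    simpa [hzD] using hz
  · simp [hx] at hy

end Aux

section Aux2

variable {n : ℕ}

lemma rot_mp (ζ : ℂ) (hζ : ‖ζ‖ = 1) :
    MeasurePreserving (fun w : EuclideanSpace ℂ (Fin n) => ζ • w) volume volume := by
  have h0 : ζ ≠ 0 := by
    rintro rfl
    simp at hζ
  have hm : Measurable (fun w : EuclideanSpace ℂ (Fin n) => ζ • w) :=
    (continuous_const_smul ζ).measurable
  refine ⟨hm, ?_⟩
  let L : EuclideanSpace ℂ (Fin n) ≃L[ℂ] EuclideanSpace ℂ (Fin n) :=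
    ContinuousLinearEquiv.smulLeft (Units.mk0 ζ h0)
  have : (Measure.map (fun w : EuclideanSpace ℂ (Fin n) => ζ • w) volume).IsAddHaarMeasure :=
    L.isAddHaarMeasure_map volume
  have e := Measure.isAddLeftInvariant_eq_smul
    (Measure.map (fun w : EuclideanSpace ℂ (Fin n) => ζ • w) volume) volume
  set c := Measure.addHaarScalarFactor
    (Measure.map (fun w : EuclideanSpace ℂ (Fin n) => ζ • w) volume) volume
  have hb := congrArg (fun μ => μ (ball 0 1)) e
  simp only [Measure.map_apply hm measurableSet_ball, Measure.smul_apply] at hb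
  have hpre : (fun w : EuclideanSpace ℂ (Fin n) => ζ • w) ⁻¹' ball 0 1 = ball 0 1 := by
    ext w
    simp [norm_smul, hζ]
  rw [hpre] at hb
  have hpos : volume (ball (0 : EuclideanSpace ℂ (Fin n)) 1) ≠ 0 :=
    (measure_ball_pos _ _ one_pos).ne'
  have hfin : volume (ball (0 : EuclideanSpace ℂ (Fin n)) 1) ≠ ⊤ := measure_ball_lt_top.ne
  have hc : c = 1 := by
    have h2 : (1 : ENNReal) * volume (ball (0 : EuclideanSpace ℂ (Fin n)) 1) =
      (c : ENNReal) * volume (ball (0 : EuclideanSpace ℂ (Fin n)) 1) := by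
      rw [one_mul]; exact hb
    have := (ENNReal.mul_left_inj hpos hfin).1 h2
    exact_mod_cast this.symm
  rw [e, hc, one_smul]

lemma ball_mean {f : EuclideanSpace ℂ (Fin n) → ENNReal} {D : Set (EuclideanSpace ℂ (Fin n))}
    (hD : IsOpen D) (hf : SupH f D) {z : EuclideanSpace ℂ (Fin n)} {r : ℝ}
    (hr : ball z r ⊆ D) :
    ∫⁻ w in ball z r, f w ≤ volume (ball z r) * f z := by
  set g := D.indicator f with hg
  have gm : Measurable g := (lsc_indicator hD hf.1).measurable
  have hpi : ENNReal.ofReal (2 * Real.pi) ≠ 0 := by simpa using Real.pi_pos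
  set h : EuclideanSpace ℂ (Fin n) → ENNReal := (ball z r).indicator g with hh
  have hm : Measurable h := gm.indicator measurableSet_ball
  have e1 : ∫⁻ w in ball z r, f w = ∫⁻ w, h w := by
    rw [← lintegral_indicator measurableSet_ball]
    congr 1
    ext w
    by_cases hw : w ∈ ball z r
    · simp [hh, hg, hw, hr hw]
    · simp [hh, hw]
  have e2 : ∀ θ : ℝ, ∫⁻ w, h w = ∫⁻ w, h (z + Complex.exp (θ * Complex.I) • w) := by
    intro θ
    rw [← lintegral_add_left_eq_self h z]
    exact ((rot_mp (n := n) _ (Complex.norm_exp_ofReal_mul_I θ)).lintegral_comp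
      (f := fun w => h (z + w)) (hm.comp (measurable_const_add z))).symm
  have e3 : ENNReal.ofReal (2 * Real.pi) * ∫⁻ w, h w =
      ∫⁻ w, ∫⁻ θ in Ioc (0:ℝ) (2 * Real.pi), h (z + Complex.exp (θ * Complex.I) • w) := by
    rw [← lintegral_lintegral_swap]
    · simp_rw [← e2]
      rw [lintegral_const]
      simp [mul_comm]
    · apply Measurable.aemeasurable
      apply hm.comp
      apply Continuous.measurable
      fun_prop
  have e4 : ∀ w, ∫⁻ θ in Ioc (0:ℝ) (2 * Real.pi), h (z + Complex.exp (θ * Complex.I) • w) ≤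
      (ball 0 r).indicator (fun _ => ENNReal.ofReal (2 * Real.pi) * f z) w := by
    intro w
    by_cases hw : w ∈ ball 0 r
    · rw [indicator_of_mem hw]
      refine le_trans (lintegral_mono fun θ => ?_) (hf.2 z w ?_)
      · exact (indicator_le_self _ _ _).trans (indicator_le_self _ _ _)
      · intro ζ hζ
        apply hr
        simp only [mem_ball, dist_zero_right, dist_self_add_left, norm_smul] at hw ⊢
        nlinarith [norm_nonneg w]
    · rw [indicator_of_notMem hw]
      have : ∀ θ : ℝ, h (z + Complex.exp (θ * Complex.I) • w) = 0 := by
        intro θ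
        apply indicator_of_notMem
        simpa [norm_smul, Complex.norm_exp_ofReal_mul_I] using hw
      simp [this]
  have e5 : ENNReal.ofReal (2 * Real.pi) * ∫⁻ w, h w ≤
      ENNReal.ofReal (2 * Real.pi) * (volume (ball z r) * f z) := by
    rw [e3]
    refine (lintegral_mono e4).trans ?_
    rw [lintegral_indicator measurableSet_ball, lintegral_const, Measure.restrict_apply_univ,
      Measure.addHaar_ball_center volume z r]
    rw [mul_assoc, mul_comm (f z)]
  rw [e1]
  exact (ENNReal.mul_le_mul_iff_right hpi ENNReal.ofReal_ne_top).1 e5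

lemma SupH.eq_top {f : EuclideanSpace ℂ (Fin n) → ENNReal} {D W : Set (EuclideanSpace ℂ (Fin n))}
    (hD : IsOpen D) (hc : IsConnected D) (hf : SupH f D) (hW : IsOpen W)
    (hne : (D ∩ W).Nonempty) (hfW : ∀ z ∈ D ∩ W, f z = ⊤) : ∀ z ∈ D, f z = ⊤ := by
  set G := interior {z | f z = ⊤} with hG
  have hGs : ∀ z ∈ G, f z = ⊤ := by
    intro z hz
    have h : z ∈ {z | f z = ⊤} := interior_subset hz
    exact h
  have hDW : D ∩ W ⊆ G := interior_maximal hfW (hD.inter hW)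
  have : D ⊆ G := by
    refine hc.isPreconnected.subset_of_closure_inter_subset isOpen_interior
      (hne.mono fun z hz => ⟨hz.1, hDW hz⟩) ?_
    rintro x ⟨hxG, hxD⟩
    obtain ⟨R, hR, hRD⟩ := Metric.isOpen_iff.1 hD x hxD
    refine mem_interior.2 ⟨ball x (R / 2), ?_, isOpen_ball, mem_ball_self (by positivity)⟩
    intro z hz
    have hsub : ball z (R / 2) ⊆ D := by
      refine (ball_subset_ball' ?_).trans hRD
      have := mem_ball.1 hz
      linarith
    have hx : x ∈ ball z (R / 2) := by rw [mem_ball, dist_comm]; exact hz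
    obtain ⟨y, hy⟩ := mem_closure_iff.1 hxG _ isOpen_ball hx
    have hop : IsOpen (ball z (R / 2) ∩ G) := isOpen_ball.inter isOpen_interior
    have hpos : volume (ball z (R / 2) ∩ G) ≠ 0 := (hop.measure_pos volume ⟨y, hy⟩).ne'
    have hint : ∫⁻ w in ball z (R / 2), f w = ⊤ := by
      rw [eq_top_iff]
      calc ⊤ = ∫⁻ w in ball z (R / 2) ∩ G, (⊤ : ENNReal) := by
              rw [lintegral_const, Measure.restrict_apply_univ, ENNReal.top_mul hpos]
        _ ≤ ∫⁻ w in ball z (R / 2) ∩ G, f w :=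
              setLIntegral_mono' hop.measurableSet fun w hw => (hGs w hw.2).ge
        _ ≤ _ := lintegral_mono_set inter_subset_left
    have hmean := ball_mean hD hf hsub
    rw [hint, top_le_iff] at hmean
    by_contra hfz
    exact ENNReal.mul_ne_top measure_ball_lt_top.ne hfz hmean
  exact fun z hz => hGs z (this hz)

lemma neg_toENNReal {x : EReal} (hx : x ≤ 0) : x = -(((-x).toENNReal : ENNReal) : EReal) := by
  rw [EReal.coe_toENNReal (by simpa using EReal.neg_le_neg_iff.2 hx), neg_neg]

end Aux2

section Main

variable {n : ℕ}

lemma bPluripolar_imp (D A : Set (EuclideanSpace ℂ (Fin n))) (hD : IsBddDomain D)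
    (h : BPluripolar A D) : ∀ x ∈ closure D, bndExtStar x A D = 0 := by
  obtain ⟨hDo, hDc, -⟩ := hD
  obtain ⟨u, hpsh, hneg, ⟨z0, hz0, hz0u⟩, hA⟩ := h
  set f : EuclideanSpace ℂ (Fin n) → ENNReal := fun z => (-u z).toENNReal with hfdef
  have huf : ∀ z ∈ D, u z = -(f z : EReal) := fun z hz => neg_toENNReal (hneg z hz)
  have hf : SupH f D := (pshOn_iff huf).1 hpsh
  have hz0f : f z0 ≠ ⊤ := by
    intro h
    apply hz0u
    rw [huf z0 hz0, h]
    rfl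
  -- the extremal function vanishes where `u` is finite
  have hge : ∀ z ∈ D, f z ≠ ⊤ → 0 ≤ bndExt z A D := by
    intro z hz hfz
    have hk : ∀ k : ℕ, -((((k : ENNReal) + 1)⁻¹ * f z : ENNReal) : EReal) ≤ bndExt z A D := by
      intro k
      set c : ENNReal := ((k : ENNReal) + 1)⁻¹ with hcdef
      have hc0 : c ≠ 0 := by simp [hcdef]
      have hct : c ≠ ⊤ := by simp [hcdef]
      refine le_sSup ⟨fun w => -((c * f w : ENNReal) : EReal), ⟨?_, z0, hz0, ?_⟩, ?_, ?_, rfl⟩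
      · exact (pshOn_iff (fun w _ => rfl)).2 (hf.const_mul hct)
      · have := ENNReal.mul_ne_top hct hz0f
        intro h
        rw [EReal.neg_eq_bot_iff] at h
        exact this (EReal.coe_ennreal_eq_top_iff.1 h)
      · intro y _
        have : (0 : EReal) ≤ ((c * f y : ENNReal) : EReal) := EReal.coe_ennreal_nonneg _
        simpa using EReal.neg_le_neg_iff.2 this
      · intro x hx
        have h1 : limsup u (𝓝[D] x) < ((-(k + 1 : ℝ) : ℝ) : EReal) := by
          have := hA x hx
          rw [uscReg] at this
          rw [this]
          exact EReal.bot_lt_coe _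
        refine limsup_le_of_le (h := ?_)
        filter_upwards [eventually_lt_of_limsup_lt h1, self_mem_nhdsWithin] with w hw hwD
        have h2 := hw.le
        rw [huf w hwD, neg_le_coe_neg_iff _ _ (by positivity)] at h2
        have h3 : ((k : ENNReal) + 1) ≤ f w := by
          refine le_trans (le_of_eq ?_) h2
          rw [ENNReal.ofReal_add (by positivity) (by positivity)]
          simp
        have h4 : (1 : ENNReal) ≤ c * f w := by
          calc (1 : ENNReal) = c * ((k : ENNReal) + 1) :=
                (ENNReal.inv_mul_cancel (by simp) (by simp)).symm
            _ ≤ c * f w := mul_le_mul_right h3 c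
        rw [EReal.neg_le_neg_iff]
        exact_mod_cast h4
    have hlim : Tendsto (fun k : ℕ => -((((k : ENNReal) + 1)⁻¹ * f z : ENNReal) : EReal)) atTop
        (𝓝 0) := by
      have h1 : Tendsto (fun k : ℕ => ((k : ENNReal) + 1)⁻¹ * f z) atTop (𝓝 (0 * f z)) := by
        refine ENNReal.Tendsto.mul_const ?_ (Or.inr hfz)
        have := (tendsto_add_atTop_iff_nat 1).2 ENNReal.tendsto_inv_nat_nhds_zero
        simpa using this
      have h2 := (continuous_neg.comp continuous_coe_ennreal_ereal).tendsto (0 * f z)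
      have h3 := h2.comp h1
      simpa [Function.comp_def] using h3
    exact le_of_tendsto' hlim hk
  intro x hx
  have hx' : (𝓝[D] x).NeBot := mem_closure_iff_nhdsWithin_neBot.1 hx
  apply le_antisymm
  · refine limsup_le_of_le (h := ?_)
    filter_upwards [self_mem_nhdsWithin] with z hz
    apply sSup_le
    rintro w ⟨v, -, hv, -, rfl⟩
    exact hv z hz
  · refine le_limsup_of_frequently_le ?_
    by_contra hcon
    rw [not_frequently] at hcon
    have hcon' : ∀ᶠ z in 𝓝[D] x, z ∈ D ∧ f z = ⊤ := by
      filter_upwards [hcon, self_mem_nhdsWithin] with z hz hzD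
      refine ⟨hzD, ?_⟩
      by_contra hne
      exact hz (hge z hzD hne)
    obtain ⟨W, hW, hxW, hWD⟩ := mem_nhdsWithin.1 hcon'
    obtain ⟨y, hy⟩ := mem_closure_iff.1 hx W hW hxW
    exact hz0f (hf.eq_top hDo hDc hW ⟨y, hy.2, hy.1⟩
      (fun z hz => (hWD ⟨hz.2, hz.1⟩).2) z0 hz0)

lemma imp_bPluripolar (D A : Set (EuclideanSpace ℂ (Fin n))) (hD : IsBddDomain D)
    (h : ∀ x ∈ closure D, bndExtStar x A D = 0) : BPluripolar A D := by
  obtain ⟨hDo, hDc, -⟩ := hD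
  obtain ⟨x0, hx0⟩ := hDc.nonempty
  obtain ⟨R, hR, hRD⟩ := Metric.isOpen_iff.1 hDo x0 hx0
  have hstep : ∀ j : ℕ, ∃ f : EuclideanSpace ℂ (Fin n) → ENNReal, SupH f D ∧
      (∀ x ∈ A, ∀ᶠ z in 𝓝[D] x, (2 : ENNReal)⁻¹ ≤ f z) ∧
      ∫⁻ w in ball x0 (R / 4), f w ≤ volume (ball x0 (R / 2)) * (2 : ENNReal)⁻¹ ^ j := by
    intro j
    have hlt : ((-((1/2 : ℝ) ^ j) : ℝ) : EReal) < bndExtStar x0 A D := by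
      rw [h x0 (subset_closure hx0)]
      have : -((1/2 : ℝ) ^ j) < 0 := by
        have : (0:ℝ) < (1/2 : ℝ) ^ j := by positivity
        linarith
      exact_mod_cast this
    have hfr := frequently_lt_of_lt_limsup (h := hlt)
    have hnear : ∀ᶠ z in 𝓝[D] x0, z ∈ ball x0 (R / 4) :=
      mem_nhdsWithin_of_mem_nhds (ball_mem_nhds x0 (by positivity))
    obtain ⟨z, hz, hzb, hzD⟩ := (hfr.and_eventually (hnear.and self_mem_nhdsWithin)).exists
    obtain ⟨w, ⟨u, ⟨hpsh, -⟩, hneg, huA, rfl⟩, hw⟩ := lt_sSup_iff.1 hz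
    set f : EuclideanSpace ℂ (Fin n) → ENNReal := fun z => (-u z).toENNReal with hfdef
    have huf : ∀ z ∈ D, u z = -(f z : EReal) := fun z hz => neg_toENNReal (hneg z hz)
    have hf : SupH f D := (pshOn_iff huf).1 hpsh
    refine ⟨f, hf, ?_, ?_⟩
    · intro x hx
      have h1 : limsup u (𝓝[D] x) < ((-(2⁻¹ : ℝ) : ℝ) : EReal) := by
        refine lt_of_le_of_lt (huA x hx) ?_
        have : (-1 : ℝ) < -(2⁻¹ : ℝ) := by norm_num
        have h5 : ((-1 : ℝ) : EReal) < ((-(2⁻¹ : ℝ) : ℝ) : EReal) := EReal.coe_lt_coe_iff.2 this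
        simpa using h5
      filter_upwards [eventually_lt_of_limsup_lt h1, self_mem_nhdsWithin] with y hy hyD
      have h2 := hy.le
      rw [huf y hyD, neg_le_coe_neg_iff _ _ (by positivity)] at h2
      simpa [ENNReal.ofReal_inv_of_pos] using h2
    · have hfz : f z ≤ (2 : ENNReal)⁻¹ ^ j := by
        have h3 : ((-((1/2 : ℝ) ^ j) : ℝ) : EReal) ≤ -(f z : EReal) := by
          rw [← huf z hzD]; exact hw.le
        rw [EReal.coe_neg, EReal.neg_le_neg_iff] at h3
        have h4 := EReal.toENNReal_le_toENNReal h3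
        rw [EReal.toENNReal_coe, EReal.toENNReal_of_ne_top (EReal.coe_ne_top _),
          EReal.toReal_coe, ENNReal.ofReal_pow (by positivity)] at h4
        simpa [ENNReal.ofReal_inv_of_pos] using h4
      have hzd := mem_ball.1 hzb
      have hsub : ball z (R / 2) ⊆ D := (ball_subset_ball' (by linarith)).trans hRD
      have hsub2 : ball x0 (R / 4) ⊆ ball z (R / 2) :=
        ball_subset_ball' (by rw [dist_comm]; linarith)
      calc ∫⁻ w in ball x0 (R / 4), f w ≤ ∫⁻ w in ball z (R / 2), f w :=
            lintegral_mono_set hsub2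
        _ ≤ volume (ball z (R / 2)) * f z := ball_mean hDo hf hsub
        _ ≤ volume (ball x0 (R / 2)) * (2 : ENNReal)⁻¹ ^ j := by
            rw [Measure.addHaar_ball_center volume z, ← Measure.addHaar_ball_center volume x0]
            exact mul_le_mul_right hfz _
  choose f hf hfA hfI using hstep
  have hS : SupH (fun z => ∑' j, f j z) D := SupH.tsum hf
  refine ⟨fun z => -((∑' j, f j z : ENNReal) : EReal), (pshOn_iff (fun w _ => rfl)).2 hS, ?_, ?_, ?_⟩
  · intro y _
    have : (0 : EReal) ≤ ((∑' j, f j y : ENNReal) : EReal) := EReal.coe_ennreal_nonneg _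
    simpa using EReal.neg_le_neg_iff.2 this
  · by_contra hcon
    push Not at hcon
    have htop : ∀ z ∈ D, ∑' j, f j z = ⊤ := by
      intro z hz
      have := hcon z hz
      simpa [EReal.neg_eq_bot_iff] using this
    have hbD : ball x0 (R / 4) ⊆ D := (ball_subset_ball (by linarith)).trans hRD
    have hmeas : ∀ j, AEMeasurable (f j) (volume.restrict (ball x0 (R / 4))) := by
      intro j
      refine ⟨D.indicator (f j), (lsc_indicator hDo (hf j).1).measurable, ?_⟩
      filter_upwards [ae_restrict_mem measurableSet_ball] with w hw
      rw [indicator_of_mem (hbD hw)]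
    have h1 : ∫⁻ w in ball x0 (R / 4), ∑' j, f j w ≤
        volume (ball x0 (R / 2)) * 2 := by
      rw [lintegral_tsum hmeas]
      refine (ENNReal.tsum_le_tsum hfI).trans ?_
      rw [ENNReal.tsum_mul_left, ENNReal.tsum_geometric, ENNReal.one_sub_inv_two, inv_inv]
    have h2 : ∫⁻ w in ball x0 (R / 4), ∑' j, f j w = ⊤ := by
      rw [setLIntegral_congr_fun measurableSet_ball (fun w hw => htop w (hbD hw)),
        lintegral_const, Measure.restrict_apply_univ,
        ENNReal.top_mul (measure_ball_pos volume x0 (by positivity)).ne']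
    rw [h2, top_le_iff] at h1
    exact ENNReal.mul_ne_top measure_ball_lt_top.ne (by simp) h1
  · intro x hx
    rw [uscReg, EReal.eq_bot_iff_forall_lt]
    intro y
    obtain ⟨N, hN⟩ := exists_nat_gt (-y)
    refine lt_of_le_of_lt (b := ((-(N : ℝ) : ℝ) : EReal)) ?_
      (EReal.coe_lt_coe_iff.2 (by linarith))
    refine limsup_le_of_le (h := ?_)
    have hev : ∀ᶠ z in 𝓝[D] x, ∀ j ∈ Finset.range (2 * N), (2 : ENNReal)⁻¹ ≤ f j z :=
      (eventually_all_finset _).2 fun j _ => hfA j x hx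
    filter_upwards [hev] with z hz
    rw [neg_le_coe_neg_iff _ _ (by positivity)]
    calc ENNReal.ofReal (N : ℝ) = N := by simp
      _ = ∑ j ∈ Finset.range (2 * N), (2 : ENNReal)⁻¹ := by
          rw [Finset.sum_const, Finset.card_range, nsmul_eq_mul]
          push_cast
          rw [mul_comm 2, mul_assoc, ENNReal.mul_inv_cancel (by simp) (by simp), mul_one]
      _ ≤ ∑ j ∈ Finset.range (2 * N), f j z := Finset.sum_le_sum hz
      _ ≤ ∑' j, f j z := ENNReal.sum_le_tsum _

end Main

/-- `A ⊆ ∂D` is b-pluripolar if and only if `ω*(·, A, D) ≡ 0`. -/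
theorem bndExtStar_eq_zero_iff_bPluripolar {n : ℕ}
    (D A : Set (EuclideanSpace ℂ (Fin n))) (hD : IsBddDomain D)
    (hA : A ⊆ frontier D) :
    (∀ x ∈ closure D, bndExtStar x A D = 0) ↔ BPluripolar A D :=
  ⟨imp_bPluripolar D A hD, bPluripolar_imp D A hD⟩
end

section
/- Let D ⊆ ℂⁿ be a bounded domain and A ⊆ ∂D b-pluripolar. Then the b-pluripolar hull satisfies Â ∩ D = {z ∈ D : ω(z, A, D) < 0}, and this set is pluripolar: it is contained in {v = -∞} for some v ∈ PSH(D) not identically -∞. -/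
open Complex Metric MeasureTheory Filter Topology Set

noncomputable section HullProof

/-- Truncation from below, as a real number. -/
def trunc (m : ℕ) (x : EReal) : ℝ := (max x ((-(m : ℝ) : ℝ) : EReal)).toReal

lemma coe_trunc (m : ℕ) {x : EReal} (hx : x ≤ 0) :
    ((trunc m x : ℝ) : EReal) = max x ((-(m : ℝ) : ℝ) : EReal) := by
  apply EReal.coe_toReal
  · apply ne_of_lt
    exact max_lt (lt_of_le_of_lt hx (EReal.coe_lt_top 0)) (EReal.coe_lt_top _)
  · apply ne_of_gt
    exact lt_of_lt_of_le (EReal.bot_lt_coe _) (le_max_right _ _)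

lemma trunc_le_zero (m : ℕ) {x : EReal} (hx : x ≤ 0) : trunc m x ≤ 0 := by
  rw [← EReal.coe_le_coe_iff, coe_trunc m hx]
  refine max_le hx ?_
  exact_mod_cast (by simp : (-(m : ℝ)) ≤ 0)

lemma neg_le_trunc (m : ℕ) {x : EReal} (hx : x ≤ 0) : -(m : ℝ) ≤ trunc m x := by
  rw [← EReal.coe_le_coe_iff, coe_trunc m hx]
  exact le_max_right _ _

lemma le_trunc (m : ℕ) {x : EReal} (hx : x ≤ 0) : x ≤ ((trunc m x : ℝ) : EReal) := by
  rw [coe_trunc m hx]; exact le_max_left _ _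

lemma trunc_anti {m k : ℕ} (h : m ≤ k) {x : EReal} (hx : x ≤ 0) : trunc k x ≤ trunc m x := by
  rw [← EReal.coe_le_coe_iff, coe_trunc m hx, coe_trunc k hx]
  refine max_le_max le_rfl ?_
  exact_mod_cast (by simpa using (by exact_mod_cast h : (m : ℝ) ≤ k) : (-(k : ℝ)) ≤ -m)

lemma trunc_measurable (m : ℕ) {f : ℝ → EReal} (hf : Measurable f) :
    Measurable (fun θ => trunc m (f θ)) :=
  (hf.max measurable_const).ereal_toReal

variable {E : Type*} [NormedAddCommGroup E] [NormedSpace ℂ E]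

/-- Parametrized circle in a complex line. -/
def circ (a b : E) (c : ℂ) (r : ℝ) (θ : ℝ) : E :=
  a + (c + (r : ℂ) * Complex.exp (θ * Complex.I)) • b

lemma circ_cont (a b : E) (c : ℂ) (r : ℝ) : Continuous (circ a b c r) := by
  unfold circ; fun_prop

lemma circ_mem {D : Set E} {a b : E} {c : ℂ} {r : ℝ} (hr : 0 < r)
    (h : Metric.closedBall c r ⊆ {ζ : ℂ | a + ζ • b ∈ D}) (θ : ℝ) : circ a b c r θ ∈ D := by
  apply h
  simp [Metric.mem_closedBall, dist_eq_norm, Complex.norm_exp_ofReal_mul_I, abs_of_pos hr]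

lemma usc_line {u : E → EReal} {D : Set E} (hu : UpperSemicontinuousOn u D) (a b : E) :
    UpperSemicontinuousOn (fun ζ : ℂ => u (a + ζ • b)) {ζ : ℂ | a + ζ • b ∈ D} := by
  have hc : Continuous (fun ζ : ℂ => a + ζ • b) := by fun_prop
  exact hu.comp (g := fun ζ : ℂ => a + ζ • b) hc.continuousOn (fun x hx => hx)

lemma circ_meas {u : E → EReal} {D : Set E} (hu : UpperSemicontinuousOn u D) {a b : E} {c : ℂ}
    {r : ℝ} (hm : ∀ θ, circ a b c r θ ∈ D) : Measurable (fun θ => u (circ a b c r θ)) := by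
  have h : UpperSemicontinuousOn (u ∘ circ a b c r) univ :=
    hu.comp (circ_cont a b c r).continuousOn (fun x _ => hm x)
  exact (upperSemicontinuousOn_univ_iff.1 h).measurable

lemma trunc_intervalIntegrable (m : ℕ) {f : ℝ → EReal} (hf : Measurable f) (h0 : ∀ θ, f θ ≤ 0)
    (p q : ℝ) : IntervalIntegrable (fun θ => trunc m (f θ)) volume p q := by
  refine (intervalIntegrable_const (c := (m : ℝ))).mono_fun
    (trunc_measurable m hf).aestronglyMeasurable ?_
  refine Eventually.of_forall fun θ => ?_
  have h1 := neg_le_trunc m (h0 θ)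
  have h2 := trunc_le_zero m (h0 θ)
  simp only [Real.norm_eq_abs]
  rw [abs_of_nonneg (Nat.cast_nonneg m : (0:ℝ) ≤ m)]
  exact abs_le.2 ⟨h1, by linarith [(Nat.cast_nonneg m : (0:ℝ) ≤ m)]⟩

/-- Normalized circle average. -/
def avg (f : ℝ → ℝ) : ℝ := (2 * Real.pi)⁻¹ * ∫ θ in (0:ℝ)..(2 * Real.pi), f θ

lemma avg_const (k : ℝ) : avg (fun _ => k) = k := by
  unfold avg
  have := Real.pi_pos
  simp only [intervalIntegral.integral_const, smul_eq_mul]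
  field_simp
  ring

lemma avg_mono {f g : ℝ → ℝ} (hf : IntervalIntegrable f volume 0 (2 * Real.pi))
    (hg : IntervalIntegrable g volume 0 (2 * Real.pi)) (h : ∀ θ, f θ ≤ g θ) : avg f ≤ avg g := by
  unfold avg
  have := Real.pi_pos
  refine mul_le_mul_of_nonneg_left ?_ (by positivity)
  exact intervalIntegral.integral_mono (by positivity) hf hg h

lemma pshOn_of {u : E → EReal} {D : Set E} (hu : UpperSemicontinuousOn u D)
    (h0 : ∀ z ∈ D, u z ≤ 0)
    (hs : ∀ (a b : E) (c : ℂ) (r : ℝ), (∀ θ, circ a b c r θ ∈ D) → a + c • b ∈ D → 0 < r →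
      Metric.closedBall c r ⊆ {ζ : ℂ | a + ζ • b ∈ D} → ∀ m : ℕ,
      u (a + c • b) ≤ ((avg (fun θ => trunc m (u (circ a b c r θ))) : ℝ) : EReal)) :
    PshOn u D := by
  refine ⟨hu, fun z hz => ((h0 z hz).trans_lt (EReal.coe_lt_top 0)).ne, fun a b => ⟨usc_line hu a b, ?_⟩⟩
  intro c r hr hb m
  exact hs a b c r (circ_mem hr hb) (hb (Metric.mem_closedBall_self hr.le)) hr hb m

lemma PshOn.le_avg {u : E → EReal} {D : Set E} (hu : PshOn u D) {a b : E} {c : ℂ} {r : ℝ}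
    (hr : 0 < r) (hb : Metric.closedBall c r ⊆ {ζ : ℂ | a + ζ • b ∈ D}) (m : ℕ) :
    u (a + c • b) ≤ ((avg (fun θ => trunc m (u (circ a b c r θ))) : ℝ) : EReal) :=
  (hu.2.2 a b).2 c r hr hb m

lemma PshOn.trunc_le_avg {u : E → EReal} {D : Set E} (hu : PshOn u D) (h0 : ∀ z ∈ D, u z ≤ 0)
    {a b : E} {c : ℂ} {r : ℝ}
    (hr : 0 < r) (hb : Metric.closedBall c r ⊆ {ζ : ℂ | a + ζ • b ∈ D}) (m : ℕ) :
    trunc m (u (a + c • b)) ≤ avg (fun θ => trunc m (u (circ a b c r θ))) := by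
  have hm := circ_mem hr hb
  rw [← EReal.coe_le_coe_iff, coe_trunc m (h0 _ (hb (Metric.mem_closedBall_self hr.le)))]
  refine max_le (hu.le_avg hr hb m) ?_
  rw [EReal.coe_le_coe_iff, ← avg_const (-(m:ℝ))]
  refine avg_mono intervalIntegrable_const
    (trunc_intervalIntegrable m (circ_meas hu.1 hm) (fun θ => h0 _ (hm θ)) _ _) ?_
  exact fun θ => neg_le_trunc m (h0 _ (hm θ))

lemma trunc_bot (m : ℕ) : trunc m ⊥ = -(m : ℝ) := by
  unfold trunc; simp only [bot_le, sup_of_le_right, EReal.toReal_coe]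

lemma ereal_coe_max (x y : ℝ) : ((max x y : ℝ) : EReal) = max (x : EReal) (y : EReal) :=
  EReal.coe_strictMono.monotone.map_max

lemma trunc_coe (m : ℕ) (x : ℝ) : trunc m (x : EReal) = max x (-(m : ℝ)) := by
  unfold trunc; rw [← ereal_coe_max, EReal.toReal_coe]

lemma trunc_sub_one (m : ℕ) {x : EReal} (hx : x ≤ 0) :
    trunc (m + 1) (x - 1) = trunc m x - 1 := by
  induction x using EReal.rec with
  | bot => rw [EReal.bot_sub, trunc_bot, trunc_bot]; push_cast; ring
  | top => simp at hx
  | coe x =>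
    have h : (x : EReal) - 1 = ((x - 1 : ℝ) : EReal) := by rw [EReal.coe_sub]; rfl
    rw [h, trunc_coe, trunc_coe, ← max_sub_sub_right]
    push_cast
    congr 1
    ring

lemma PshOn.sub_one {u : E → EReal} {D : Set E} (hu : PshOn u D) (h0 : ∀ z ∈ D, u z ≤ 0) :
    PshOn (fun z => u z - 1) D := by
  have hneg : ∀ z ∈ D, u z - 1 ≤ 0 := fun z hz => by
    refine EReal.sub_nonpos.2 ((h0 z hz).trans zero_le_one)
  refine pshOn_of ?_ hneg ?_
  · intro x hx y hy
    have one_b : (1:EReal) ≠ ⊥ := EReal.coe_ne_bot 1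
    have one_t : (1:EReal) ≠ ⊤ := EReal.coe_ne_top 1
    have hy' := (EReal.sub_lt_iff (Or.inl one_b) (Or.inl one_t)).1 hy
    filter_upwards [hu.1 x hx _ hy'] with z hz
    exact (EReal.sub_lt_iff (Or.inl one_b) (Or.inl one_t)).2 hz
  · intro a b c r hm hc hr hb m
    cases m with
    | zero =>
      have : (fun θ => trunc 0 (u (circ a b c r θ) - 1)) = fun _ => 0 := by
        funext θ
        have h1 := trunc_le_zero 0 (hneg _ (hm θ))
        have h2 := neg_le_trunc 0 (hneg _ (hm θ))
        simp at h2
        exact le_antisymm h1 h2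
      rw [this, avg_const]
      exact hneg _ hc
    | succ m =>
      have h1 := hu.le_avg hr hb m
      have e : avg (fun θ => trunc (m+1) (u (circ a b c r θ) - 1))
          = avg (fun θ => trunc m (u (circ a b c r θ))) - 1 := by
        simp only [trunc_sub_one m (h0 _ (hm _))]
        have h3 := avg_const 1
        unfold avg at h3 ⊢
        rw [intervalIntegral.integral_sub
          (trunc_intervalIntegrable m (circ_meas hu.1 hm) (fun θ => h0 _ (hm θ)) _ _)
          intervalIntegrable_const, mul_sub, h3]
      rw [e, EReal.coe_sub]
      exact EReal.sub_le_sub h1 le_rfl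

lemma div_nonpos' {k : ℕ} {x : EReal} (hx : x ≤ 0) : x / (k : EReal) ≤ 0 := by
  exact EReal.div_nonpos_of_nonpos_of_nonneg hx (by exact_mod_cast Nat.zero_le k)

lemma trunc_div (m : ℕ) {k : ℕ} (hk : 0 < k) {x : EReal} (hx : x ≤ 0) :
    trunc m (x / (k : EReal)) = (k : ℝ)⁻¹ * trunc (k * m) x := by
  have hk' : (0:ℝ) < k := by exact_mod_cast hk
  induction x using EReal.rec with
  | bot =>
    rw [EReal.bot_div_of_pos_ne_top (by exact_mod_cast hk) (EReal.natCast_ne_top k),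
      trunc_bot, trunc_bot]
    push_cast
    field_simp
  | top => simp at hx
  | coe x =>
    have h2 : ((x : EReal) / (k : EReal)) = ((x / k : ℝ) : EReal) := by
      rw [EReal.coe_div]; rfl
    rw [h2, trunc_coe, trunc_coe, mul_max_of_nonneg _ _ (by positivity)]
    push_cast
    congr 1
    · field_simp
    · field_simp

lemma PshOn.div_nat {u : E → EReal} {D : Set E} (hu : PshOn u D) (h0 : ∀ z ∈ D, u z ≤ 0)
    {k : ℕ} (hk : 0 < k) : PshOn (fun z => u z / (k : EReal)) D := by
  have hk1 : (0:EReal) < k := by exact_mod_cast hk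
  have hk2 : (k:EReal) ≠ ⊤ := EReal.natCast_ne_top k
  refine pshOn_of ?_ (fun z hz => div_nonpos' (h0 z hz)) ?_
  · intro x hx y hy
    have hy' := (EReal.div_lt_iff hk1 hk2).1 hy
    filter_upwards [hu.1 x hx _ hy'] with z hz
    exact (EReal.div_lt_iff hk1 hk2).2 hz
  · intro a b c r hm hc hr hb m
    have h1 := hu.le_avg hr hb (k * m)
    have e : avg (fun θ => trunc m (u (circ a b c r θ) / (k:EReal)))
        = (k:ℝ)⁻¹ * avg (fun θ => trunc (k * m) (u (circ a b c r θ))) := by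
      simp only [trunc_div m hk (h0 _ (hm _))]
      unfold avg
      rw [intervalIntegral.integral_const_mul]
      ring
    rw [e, EReal.div_le_iff_le_mul hk1 hk2]
    refine h1.trans (le_of_eq ?_)
    have : (k:EReal) = ((k:ℝ):EReal) := rfl
    rw [this, ← EReal.coe_mul, EReal.coe_eq_coe_iff]
    have hk' : (k:ℝ) ≠ 0 := by exact_mod_cast hk.ne'
    field_simp

/-- Truncated partial sums. -/
def pSum (u : ℕ → E → EReal) (N : ℕ) (z : E) : ℝ := ∑ k ∈ Finset.range N, trunc N (u k z)

/-- Infinite sum of nonpositive functions. -/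
def iSum (u : ℕ → E → EReal) (z : E) : EReal := ⨅ N, ((pSum u N z : ℝ) : EReal)

lemma pSum_anti {u : ℕ → E → EReal} {z : E} (h : ∀ k, u k z ≤ 0) :
    Antitone (fun N => pSum u N z) := by
  refine antitone_nat_of_succ_le fun N => ?_
  unfold pSum
  rw [Finset.sum_range_succ]
  have h1 : ∑ k ∈ Finset.range N, trunc (N+1) (u k z) ≤ ∑ k ∈ Finset.range N, trunc N (u k z) :=
    Finset.sum_le_sum fun k _ => trunc_anti (Nat.le_succ N) (h k)
  linarith [trunc_le_zero (N+1) (h N)]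

lemma pSum_nonpos {u : ℕ → E → EReal} {z : E} (h : ∀ k, u k z ≤ 0) (N : ℕ) : pSum u N z ≤ 0 :=
  Finset.sum_nonpos fun k _ => trunc_le_zero N (h k)

lemma iSum_nonpos {u : ℕ → E → EReal} {z : E} (h : ∀ k, u k z ≤ 0) : iSum u z ≤ 0 :=
  (iInf_le _ 0).trans (by exact_mod_cast pSum_nonpos h 0)

lemma trunc_usc {u : E → EReal} {D : Set E} (hu : UpperSemicontinuousOn u D)
    (h0 : ∀ z ∈ D, u z ≤ 0) (m : ℕ) : UpperSemicontinuousOn (fun z => trunc m (u z)) D := by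
  intro x hx y hy
  have hy1 : ((trunc m (u x) : ℝ) : EReal) < (y : EReal) := EReal.coe_lt_coe_iff.2 hy
  rw [coe_trunc m (h0 x hx), max_lt_iff] at hy1
  filter_upwards [hu x hx _ hy1.1, self_mem_nhdsWithin] with z hz hzD
  rw [← EReal.coe_lt_coe_iff, coe_trunc m (h0 z hzD)]
  exact max_lt hz hy1.2

lemma pSum_usc {u : ℕ → E → EReal} {D : Set E} (hu : ∀ k, UpperSemicontinuousOn (u k) D)
    (h0 : ∀ k, ∀ z ∈ D, u k z ≤ 0) (N : ℕ) : 
    UpperSemicontinuousOn (fun z => ((pSum u N z : ℝ) : EReal)) D := by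
  have h : UpperSemicontinuousOn (fun z => pSum u N z) D := by
    unfold pSum
    exact upperSemicontinuousOn_sum fun k _ => trunc_usc (hu k) (h0 k) N
  intro x hx
  exact continuous_coe_real_ereal.continuousAt.comp_upperSemicontinuousWithinAt (h x hx)
    (fun a b hab => EReal.coe_le_coe_iff.2 hab)

lemma iSum_usc {u : ℕ → E → EReal} {D : Set E} (hu : ∀ k, UpperSemicontinuousOn (u k) D)
    (h0 : ∀ k, ∀ z ∈ D, u k z ≤ 0) : UpperSemicontinuousOn (iSum u) D :=
  upperSemicontinuousOn_iInf fun N => pSum_usc hu h0 N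

lemma iSum_psh {u : ℕ → E → EReal} {D : Set E} (hu : ∀ k, PshOn (u k) D)
    (h0 : ∀ k, ∀ z ∈ D, u k z ≤ 0) : PshOn (iSum u) D := by
  refine pshOn_of (iSum_usc (fun k => (hu k).1) h0) (fun z hz => iSum_nonpos fun k => h0 k z hz) ?_
  intro a b c r hm hc hr hb m
  have hsum0 : ∀ N θ, ((pSum u N (circ a b c r θ) : ℝ) : EReal) ≤ 0 := fun N θ => by
    exact_mod_cast pSum_nonpos (fun k => h0 k _ (hm θ)) N
  have hmeas : ∀ N, Measurable (fun θ => ((pSum u N (circ a b c r θ) : ℝ) : EReal)) := fun N =>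
    circ_meas (pSum_usc (fun k => (hu k).1) h0 N) hm
  have key : ∀ N, iSum u (a + c • b) ≤
      ((avg (fun θ => trunc m ((pSum u N (circ a b c r θ) : ℝ) : EReal)) : ℝ) : EReal) := by
    intro N
    refine (iInf_le _ N).trans ?_
    rw [EReal.coe_le_coe_iff]
    have hint : ∀ k, IntervalIntegrable (fun θ => trunc N (u k (circ a b c r θ))) volume 0
        (2 * Real.pi) := fun k =>
      trunc_intervalIntegrable N (circ_meas (hu k).1 hm) (fun θ => h0 k _ (hm θ)) _ _
    have e : avg (fun θ => pSum u N (circ a b c r θ)) =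
        ∑ k ∈ Finset.range N, avg (fun θ => trunc N (u k (circ a b c r θ))) := by
      unfold avg pSum
      rw [intervalIntegral.integral_finsetSum (fun k _ => hint k), Finset.mul_sum]
    have hintS : IntervalIntegrable (fun θ => pSum u N (circ a b c r θ)) volume 0
        (2 * Real.pi) := by
      have := IntervalIntegrable.sum (Finset.range N)
        (f := fun k θ => trunc N (u k (circ a b c r θ))) (fun k _ => hint k)
      refine this.congr (fun θ _ => ?_)
      simp [pSum]
    calc pSum u N (a + c • b) 
        ≤ ∑ k ∈ Finset.range N, avg (fun θ => trunc N (u k (circ a b c r θ))) :=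
          Finset.sum_le_sum fun k _ => (hu k).trunc_le_avg (h0 k) hr hb N
      _ = avg (fun θ => pSum u N (circ a b c r θ)) := e.symm
      _ ≤ _ := avg_mono hintS (trunc_intervalIntegrable m (hmeas N) (hsum0 N) _ _)
          (fun θ => EReal.coe_le_coe_iff.1 (le_trunc m (hsum0 N θ)))
  have lim : Tendsto (fun N => avg (fun θ => trunc m ((pSum u N (circ a b c r θ) : ℝ) : EReal)))
      atTop (𝓝 (avg (fun θ => trunc m (iSum u (circ a b c r θ))))) := by
    unfold avg
    refine Tendsto.const_mul _ ?_
    refine intervalIntegral.tendsto_integral_filter_of_dominated_convergence (fun _ => (m:ℝ))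
      (Eventually.of_forall fun N => (trunc_measurable m (hmeas N)).aestronglyMeasurable)
      (Eventually.of_forall fun N => Eventually.of_forall fun θ _ => ?_)
      intervalIntegrable_const (Eventually.of_forall fun θ _ => ?_)
    · have h1 := neg_le_trunc m (hsum0 N θ)
      have h2 := trunc_le_zero m (hsum0 N θ)
      rw [Real.norm_eq_abs]
      exact abs_le.2 ⟨h1, by linarith [(Nat.cast_nonneg m : (0:ℝ) ≤ m)]⟩
    · have hi0 : iSum u (circ a b c r θ) ≤ 0 := iSum_nonpos fun k => h0 k _ (hm θ)
      have t1 : Tendsto (fun N => ((pSum u N (circ a b c r θ) : ℝ) : EReal)) atTop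
          (𝓝 (iSum u (circ a b c r θ))) :=
        tendsto_atTop_iInf fun i j hij =>
          EReal.coe_le_coe_iff.2 (pSum_anti (fun k => h0 k _ (hm θ)) hij)
      have t2 := t1.max (tendsto_const_nhds (x := ((-(m : ℝ) : ℝ) : EReal)))
      refine (EReal.tendsto_toReal ?_ ?_).comp t2
      · rw [← coe_trunc m hi0]; exact EReal.coe_ne_top _
      · rw [← coe_trunc m hi0]; exact EReal.coe_ne_bot _
  exact ge_of_tendsto ((continuous_coe_real_ereal.tendsto _).comp lim) (Eventually.of_forall key)

lemma uscReg_eq {u : E → EReal} {D : Set E} (hu : PshOn u D) {z : E} (hz : z ∈ D) :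
    uscReg u D z = u z := by
  refine le_antisymm (upperSemicontinuousOn_iff_limsup_le.1 hu.1 z hz) ?_
  unfold uscReg
  refine le_limsup_of_frequently_le' ?_
  refine Filter.Frequently.filter_mono ?_ (pure_le_nhdsWithin hz)
  simp

lemma uscReg_sub_one_eq_bot {u : E → EReal} {D : Set E} {x : E} (h : uscReg u D x = ⊥) :
    uscReg (fun z => u z - 1) D x = ⊥ := by
  rw [eq_bot_iff, ← h]
  refine limsup_le_limsup (Eventually.of_forall fun z => ?_)
  have : u z - 1 ≤ u z - 0 := EReal.sub_le_sub le_rfl zero_le_one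
  simpa using this

lemma sub_one_lt_zero {x : EReal} (hx : x ≤ 0) : x - 1 < 0 := by
  induction x using EReal.rec with
  | bot => simp
  | top => simp at hx
  | coe x =>
    have : ((x - 1 : ℝ) : EReal) < 0 := by
      norm_cast at hx ⊢; linarith
    simpa using this

lemma sub_one_eq_bot {x : EReal} : x - 1 = ⊥ ↔ x = ⊥ := by
  induction x using EReal.rec with
  | bot => simp
  | top => 
    have : (⊤ : EReal) - 1 = ⊤ := EReal.top_sub_coe 1
    simp [this]
  | coe x =>
    have : ((x - 1 : ℝ) : EReal) ≠ ⊥ := EReal.coe_ne_bot _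
    simpa using this

lemma hull_subset {D A : Set E} {z : E} (hz : z ∈ D) (hh : z ∈ bHull A D) : bndExt z A D < 0 := by
  by_contra hcon
  rw [not_lt] at hcon
  have hex : ∀ k : ℕ, ∃ u : E → EReal, MemPSH u D ∧ (∀ y ∈ D, u y ≤ 0) ∧
      (∀ x ∈ A, uscReg u D x ≤ -1) ∧ ((-((1/2 : ℝ) ^ k) : ℝ) : EReal) < u z := by
    intro k
    have : ((-((1/2 : ℝ) ^ k) : ℝ) : EReal) < bndExt z A D := by
      refine lt_of_lt_of_le ?_ hcon
      have : -((1/2 : ℝ) ^ k) < 0 := by simp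
      exact_mod_cast this
    obtain ⟨w, ⟨u, h1, h2, h3, rfl⟩, h4⟩ := lt_sSup_iff.1 this
    exact ⟨u, h1, h2, h3, h4⟩
  choose u hu h0 hA hzk using hex
  have hpsh := iSum_psh (fun k => (hu k).1) h0
  have hi0 : ∀ y ∈ D, iSum u y ≤ 0 := fun y hy => iSum_nonpos fun k => h0 k y hy
  have hfin : iSum u z ≠ ⊥ := by
    have : ((-2 : ℝ) : EReal) ≤ iSum u z := by
      refine le_iInf fun N => ?_
      rw [EReal.coe_le_coe_iff]
      have h1 : ∑ k ∈ Finset.range N, -((1/2 : ℝ) ^ k) ≤ pSum u N z := by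
        refine Finset.sum_le_sum fun k _ => ?_
        rw [← EReal.coe_le_coe_iff]
        exact (hzk k).le.trans (le_trunc N (h0 k z hz))
      have h2 : ∑ k ∈ Finset.range N, ((1/2 : ℝ) ^ k) ≤ 2 := by
        have := Summable.sum_le_tsum (Finset.range N) (fun i _ => by positivity) summable_geometric_two
        rwa [tsum_geometric_two] at this
      rw [Finset.sum_neg_distrib] at h1
      linarith
    exact ((EReal.bot_lt_coe _).trans_le this).ne'
  have hbot : ∀ x ∈ A, uscReg (iSum u) D x = ⊥ := by
    intro x hx
    rw [EReal.eq_bot_iff_forall_lt]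
    intro y
    obtain ⟨N, hN⟩ := exists_nat_gt (max (2 * (1 - y)) 1)
    have hN1 : 2 * (1 - y) < N := (le_max_left _ _).trans_lt hN
    have hN2 : (1 : ℝ) < N := (le_max_right _ _).trans_lt hN
    have hev : ∀ k, ∀ᶠ w in 𝓝[D] x, u k w < ((-(1/2) : ℝ) : EReal) := by
      intro k
      refine eventually_lt_of_limsup_lt ((hA k x hx).trans_lt ?_)
      have : ((-1 : ℝ) : EReal) < ((-(1/2) : ℝ) : EReal) := by
        rw [EReal.coe_lt_coe_iff]; norm_num
      simpa using this
    have hev2 : ∀ᶠ w in 𝓝[D] x, ∀ k ∈ Finset.range N, u k w < ((-(1/2) : ℝ) : EReal) :=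
      (Filter.eventually_all_finset _).2 fun k _ => hev k
    have hle : uscReg (iSum u) D x ≤ ((y - 1 : ℝ) : EReal) := by
      refine sInf_le ?_
      rw [mem_setOf_eq, eventually_map]
      filter_upwards [hev2, self_mem_nhdsWithin] with w hw hwD
      refine (iInf_le _ N).trans ?_
      rw [EReal.coe_le_coe_iff]
      have : pSum u N w ≤ ∑ k ∈ Finset.range N, (-(1/2) : ℝ) := by
        refine Finset.sum_le_sum fun k hk => ?_
        rw [← EReal.coe_le_coe_iff, coe_trunc N (h0 k w hwD)]
        refine max_le (hw k hk).le ?_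
        rw [EReal.coe_le_coe_iff]
        linarith
      rw [Finset.sum_const, Finset.card_range, nsmul_eq_mul] at this
      linarith
    refine hle.trans_lt ?_
    rw [EReal.coe_lt_coe_iff]; linarith
  have hP := hpsh.sub_one hi0
  have := hh.2 _ hP (fun y hy => sub_one_lt_zero (hi0 y hy))
    ⟨z, hz, fun h => hfin (sub_one_eq_bot.1 h)⟩ (fun x hx => uscReg_sub_one_eq_bot (hbot x hx))
  rw [uscReg_eq hP hz] at this
  exact hfin (sub_one_eq_bot.1 this)

lemma subset_hull {D A : Set E} {z : E} (hz : z ∈ D) (hh : bndExt z A D < 0) : z ∈ bHull A D := by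
  refine ⟨subset_closure hz, fun u hu hneg hne hA => ?_⟩
  rw [uscReg_eq hu hz]
  by_contra hbot
  have h0 : ∀ y ∈ D, u y ≤ 0 := fun y hy => (hneg y hy).le
  have hle : ∀ k : ℕ, 0 < k → u z / (k : EReal) ≤ bndExt z A D := by
    intro k hk
    have hk1 : (0:EReal) < k := by exact_mod_cast hk
    have hk2 : (k:EReal) ≠ ⊤ := EReal.natCast_ne_top k
    have hk' : (0:ℝ) < k := by exact_mod_cast hk
    refine le_sSup ⟨fun y => u y / (k : EReal), ⟨hu.div_nat h0 hk, z, hz, ?_⟩,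
      fun y hy => div_nonpos' (h0 y hy), fun x hx => ?_, rfl⟩
    · intro h
      have := (EReal.div_le_iff_le_mul hk1 hk2).1 h.le
      rw [EReal.mul_bot_of_pos hk1] at this
      exact hbot (le_bot_iff.1 this)
    · have : limsup u (𝓝[D] x) < ((-(k:ℝ) : ℝ) : EReal) := by
        have h := hA x hx
        unfold uscReg at h
        rw [h]; exact EReal.bot_lt_coe _
      refine sInf_le ?_
      rw [mem_setOf_eq, eventually_map]
      filter_upwards [eventually_lt_of_limsup_lt this] with w hw
      rw [EReal.div_le_iff_le_mul hk1 hk2]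
      refine hw.le.trans (le_of_eq ?_)
      simp
  obtain ⟨t, ht⟩ : ∃ t : ℝ, u z = (t : EReal) :=
    ⟨(u z).toReal, (EReal.coe_toReal (hu.2.1 z hz) hbot).symm⟩
  have hdiv : ∀ k : ℕ, u z / (k : EReal) = ((t / k : ℝ) : EReal) := fun k => by
    rw [ht, EReal.coe_div]; rfl
  have hlim : Tendsto (fun k : ℕ => ((t / k : ℝ) : EReal)) atTop (𝓝 ((0 : ℝ) : EReal)) :=
    (continuous_coe_real_ereal.tendsto _).comp (tendsto_const_div_atTop_nhds_zero_nat t)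
  have : ((0:ℝ) : EReal) ≤ bndExt z A D := by
    refine le_of_tendsto hlim ?_
    filter_upwards [eventually_gt_atTop 0] with k hk
    rw [← hdiv]; exact hle k hk
  exact absurd hh (not_lt.2 (by simpa using this))

end HullProof

/-- For b-pluripolar `A ⊆ ∂D`, the part of the b-pluripolar hull inside
`D` is `{z ∈ D : ω(z, A, D) < 0}`, and this set is pluripolar in `D`. -/
theorem bHull_inter_eq_and_pluripolar {n : ℕ}
    (D A : Set (EuclideanSpace ℂ (Fin n))) (hD : IsBddDomain D)
    (hA : A ⊆ frontier D) (hbp : BPluripolar A D) :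
    bHull A D ∩ D = {z ∈ D | bndExt z A D < 0} ∧
    ∃ v : EuclideanSpace ℂ (Fin n) → EReal, PshOn v D ∧ (∃ z ∈ D, v z ≠ ⊥) ∧
      ∀ z ∈ bHull A D ∩ D, v z = ⊥ := by
  constructor
  · ext z
    exact ⟨fun h => ⟨h.2, hull_subset h.2 h.1⟩, fun h => ⟨subset_hull h.1 h.2, h.1⟩⟩
  · obtain ⟨u, hu, h0, ⟨y, hy, hyb⟩, hb⟩ := hbp
    have hP := hu.sub_one h0
    refine ⟨fun z => u z - 1, hP, ⟨y, hy, fun h => hyb (sub_one_eq_bot.1 h)⟩, fun z hz => ?_⟩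
    have := hz.1.2 _ hP (fun y hy => sub_one_lt_zero (h0 y hy))
      ⟨y, hy, fun h => hyb (sub_one_eq_bot.1 h)⟩ (fun x hx => uscReg_sub_one_eq_bot (hb x hx))
    rwa [uscReg_eq hP hz.2] at this
end
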